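/- Let Y > 1, γ > 0, and let c > 1 with c not an integer. Let A(Y; c, γ) denote the number of integer quadruples (n₁, n₂, n₃, n₄) with Y < n₁, n₂, n₃, n₄ ≤ 2Y and |n₁^c + n₂^c − n₃^c − n₄^c| < γ. Then for every η > 0, A(Y; c, γ) ≪ (γ Y^{4−c} + Y²) Y^η, where the implied constant depends only on c and η. -/

import Mathlib

open Finset

/-- The second moment of an exponential sum over frequencies distinct modulo `M`. -/
theorem sum_norm_sq_stdAddChar {ι : Type*} [Fintype ι] [DecidableEq ι] {M : ℕ} [NeZero M]
    (S : Finset (ι → ℤ))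
    (hS : ∀ n ∈ S, ∀ n' ∈ S, (∀ i, ((n i : ℤ) : ZMod M) = (n' i : ℤ)) → n = n') :
    ∑ r : ι → ZMod M, ‖∑ n ∈ S, ZMod.stdAddChar (∑ i, (n i : ZMod M) * r i)‖ ^ 2 =
      (M : ℝ) ^ Fintype.card ι * S.card := by
  let hom (n : ι → ℤ) : (ι → ZMod M) →+ ZMod M :=
    { toFun := fun r => ∑ i, (n i : ZMod M) * r i
      map_zero' := by simp
      map_add' := fun r r' => by simp [mul_add, Finset.sum_add_distrib] }
  have key : ∀ n ∈ S, ∀ n' ∈ S, ∑ r : ι → ZMod M,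
      ZMod.stdAddChar (∑ i, (n i : ZMod M) * r i) *
        (starRingEnd ℂ) (ZMod.stdAddChar (∑ i, (n' i : ZMod M) * r i)) =
      if n = n' then (M : ℂ) ^ Fintype.card ι else 0 := by
    intro n hn n' hn'
    let ψ : AddChar (ι → ZMod M) ℂ := ZMod.stdAddChar.compAddMonoidHom (hom (n - n'))
    have h1 : ∀ r, ψ r = ZMod.stdAddChar (∑ i, (n i : ZMod M) * r i) *
        (starRingEnd ℂ) (ZMod.stdAddChar (∑ i, (n' i : ZMod M) * r i)) := by
      intro r
      rw [← AddChar.map_neg_eq_conj, ← AddChar.map_add_eq_mul]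
      simp [ψ, hom, sub_mul, Finset.sum_sub_distrib, ← sub_eq_add_neg]
    rw [← Finset.sum_congr rfl (fun r _ => h1 r), AddChar.sum_eq_ite]
    have h2 : ψ = 0 ↔ n = n' := by
      constructor
      · intro h
        refine hS n hn n' hn' fun i => ?_
        have h3 : ψ (Pi.single i 1) = 1 := by rw [h]; simp
        have h4 : ZMod.stdAddChar (((n i - n' i : ℤ)) : ZMod M) = 1 := by
          rw [← h3]
          simp [ψ, hom, Pi.single_apply]
        rw [← AddChar.map_zero_eq_one (ZMod.stdAddChar (N := M))] at h4
        have := ZMod.injective_stdAddChar h4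
        push_cast at this
        exact sub_eq_zero.mp this
      · rintro rfl
        ext r
        simp [ψ, hom]
    simp [h2, ZMod.card]
  have hc : ((∑ r : ι → ZMod M, ‖∑ n ∈ S, ZMod.stdAddChar (∑ i, (n i : ZMod M) * r i)‖ ^ 2 :
      ℝ) : ℂ) = (M : ℂ) ^ Fintype.card ι * S.card := by
    push_cast
    simp_rw [← Complex.mul_conj', map_sum, Finset.sum_mul_sum]
    rw [Finset.sum_comm]
    have : ∀ n ∈ S, ∑ r : ι → ZMod M, ∑ n' ∈ S,
        ZMod.stdAddChar (∑ i, (n i : ZMod M) * r i) *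
        (starRingEnd ℂ) (ZMod.stdAddChar (∑ i, (n' i : ZMod M) * r i)) =
        (M : ℂ) ^ Fintype.card ι := by
      intro n hn
      rw [Finset.sum_comm, Finset.sum_congr rfl (fun n' hn' => key n hn n' hn')]
      simp [hn]
    rw [Finset.sum_congr rfl this]
    simp [mul_comm]
  exact_mod_cast hc

/-- If every `y ∈ X` pairs with every `n ∈ S` to at most `M / 8`, and each residue class modulo
`M` contains at most `N` elements of `X`, then `|X| |S| ≤ 2 N M ^ d`. -/
theorem card_mul_card_le_of_small_pairing {ι : Type*} [Fintype ι] [DecidableEq ι] {M : ℕ}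
    [NeZero M] (S X : Finset (ι → ℤ))
    (hS : ∀ n ∈ S, ∀ n' ∈ S, (∀ i, ((n i : ℤ) : ZMod M) = (n' i : ℤ)) → n = n')
    (hXS : ∀ n ∈ S, ∀ y ∈ X, |∑ i, (n i : ℝ) * y i| ≤ M / 8) (N : ℝ)
    (hN : ∀ r : ι → ZMod M, ((X.filter fun y => (fun i => ((y i : ℤ) : ZMod M)) = r).card : ℝ)
      ≤ N) :
    (X.card : ℝ) * S.card ≤ 2 * N * M ^ Fintype.card ι := by
  classical
  rcases S.eq_empty_or_nonempty with rfl | hne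
  · have : 0 ≤ N := le_trans (by positivity) (hN 0)
    simp only [Finset.card_empty, Nat.cast_zero, mul_zero]
    positivity
  have hM : (0 : ℝ) < M := Nat.cast_pos.mpr (NeZero.pos M)
  set g : (ι → ZMod M) → ℝ :=
    fun r => ‖∑ n ∈ S, ZMod.stdAddChar (∑ i, (n i : ZMod M) * r i)‖ ^ 2 with hg
  set red : (ι → ℤ) → (ι → ZMod M) := fun y i => ((y i : ℤ) : ZMod M) with hred
  have hlow : ∀ y ∈ X, (S.card : ℝ) ^ 2 / 2 ≤ g (red y) := by
    intro y hy
    have hre : ∀ n ∈ S, √2 / 2 ≤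
        (ZMod.stdAddChar (∑ i, (n i : ZMod M) * red y i) : ℂ).re := by
      intro n hn
      have h1 : (∑ i, (n i : ZMod M) * red y i) = ((∑ i, n i * y i : ℤ) : ZMod M) := by
        simp [red]
      rw [h1, ZMod.stdAddChar_coe]
      have h2 : (2 * Real.pi * Complex.I * ((∑ i, n i * y i : ℤ) : ℂ) / M : ℂ) =
          ((2 * Real.pi * (∑ i, (n i : ℝ) * y i) / M : ℝ) : ℂ) * Complex.I := by
        push_cast; ring
      rw [h2, Complex.exp_ofReal_mul_I_re, ← Real.cos_pi_div_four,
        ← Real.cos_abs (2 * Real.pi * _ / _)]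
      have h3 : |2 * Real.pi * (∑ i, (n i : ℝ) * y i) / M| ≤ Real.pi / 4 := by
        rw [abs_div, abs_mul, abs_of_pos hM, abs_of_pos Real.two_pi_pos, div_le_iff₀ hM]
        nlinarith [hXS n hn y hy, Real.pi_pos]
      exact Real.cos_le_cos_of_nonneg_of_le_pi (abs_nonneg _) (by linarith [Real.pi_pos]) h3
    have hsum : (S.card : ℝ) * (√2 / 2) ≤
        ‖∑ n ∈ S, ZMod.stdAddChar (∑ i, (n i : ZMod M) * red y i)‖ := by
      refine le_trans ?_ (Complex.re_le_norm _)
      rw [Complex.re_sum, ← nsmul_eq_mul]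
      exact Finset.card_nsmul_le_sum _ _ _ hre
    have h5 : (0 : ℝ) ≤ (S.card : ℝ) * (√2 / 2) := by positivity
    have h6 := pow_le_pow_left₀ h5 hsum 2
    have h7 : ((S.card : ℝ) * (√2 / 2)) ^ 2 = (S.card : ℝ) ^ 2 / 2 := by
      rw [mul_pow, div_pow, Real.sq_sqrt (by norm_num)]; ring
    rw [h7] at h6
    exact h6
  have htot : ∑ y ∈ X, g (red y) ≤ N * ((M : ℝ) ^ Fintype.card ι * S.card) := by
    rw [← sum_norm_sq_stdAddChar S hS, Finset.mul_sum,
      ← Finset.sum_fiberwise X red (fun y => g (red y))]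
    refine Finset.sum_le_sum fun r _ => ?_
    rw [Finset.sum_congr rfl (g := fun _ => g r) (by
      intro y hy; rw [(Finset.mem_filter.mp hy).2])]
    rw [Finset.sum_const, nsmul_eq_mul]
    exact mul_le_mul_of_nonneg_right (hN r) (by positivity)
  have hlow' : (X.card : ℝ) * ((S.card : ℝ) ^ 2 / 2) ≤ ∑ y ∈ X, g (red y) := by
    rw [← nsmul_eq_mul]
    exact Finset.card_nsmul_le_sum _ _ _ hlow
  have hSpos : (0 : ℝ) < S.card := Nat.cast_pos.mpr hne.card_pos
  have := hlow'.trans htot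
  nlinarith

theorem card_le_mul_card_dual (q₁ q₂ q₄ α₁ α₂ : ℝ) {A B D : ℝ} (hA : 0 < A) (hB : 0 < B)
    (hD : 0 < D) (S T : Finset (Fin 4 → ℤ))
    (hS : ∀ n ∈ S, |n 0 - α₁ * n 3| ≤ A ∧ |n 1 - α₂ * n 3| ≤ A ∧ |(n 3 : ℝ)| ≤ B ∧
      |q₁ * n 0 + q₂ * n 1 - n 2 - q₄ * n 3| ≤ D)
    (hT : ∀ l : Fin 4 → ℤ, |(l 2 : ℝ)| ≤ 1 / (16 * D) → |l 0 + q₁ * l 2| ≤ 1 / (16 * A) →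
      |l 1 + q₂ * l 2| ≤ 1 / (16 * A) →
      |(l 3 - q₄ * l 2) + α₁ * (l 0 + q₁ * l 2) + α₂ * (l 1 + q₂ * l 2)| ≤ 1 / (16 * B) →
      l ∈ T) :
    (S.card : ℝ) ≤ 2 ^ 25 * (D * A ^ 2 * B) * T.card := by
  classical
  obtain ⟨M, hMD, hMA, hMB, hMS⟩ : ∃ M : ℕ, 32 * D ≤ M ∧ 32 * A ≤ M ∧ 32 * B ≤ M ∧
      ∀ n ∈ S, ∀ i, 2 * |n i| < M := by
    obtain ⟨m, hm⟩ := exists_nat_ge (max (32 * D) (max (32 * A) (32 * B)))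
    simp only [max_le_iff] at hm
    refine ⟨m + (2 * ∑ n ∈ S, ∑ i, (n i).natAbs + 1), ?_, ?_, ?_, ?_⟩
    · push_cast; refine hm.1.trans (le_add_of_nonneg_right (by positivity))
    · push_cast; refine hm.2.1.trans (le_add_of_nonneg_right (by positivity))
    · push_cast; refine hm.2.2.trans (le_add_of_nonneg_right (by positivity))
    · intro n hn i
      have h1 : (n i).natAbs ≤ ∑ i, (n i).natAbs :=
        Finset.single_le_sum (f := fun i => (n i).natAbs) (fun _ _ => Nat.zero_le _)
          (Finset.mem_univ i)
      have h2 : ∑ i, (n i).natAbs ≤ ∑ n ∈ S, ∑ i, (n i).natAbs :=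
        Finset.single_le_sum (f := fun n : Fin 4 → ℤ => ∑ i, (n i).natAbs)
          (fun _ _ => Nat.zero_le _) hn
      rw [Int.abs_eq_natAbs]
      omega
  have hM : (0 : ℝ) < M := by linarith
  have : NeZero M := ⟨by rintro rfl; simp at hM⟩
  set rD : ℝ := M / (32 * D) with hrD
  set rA : ℝ := M / (32 * A) with hrA
  set rB : ℝ := M / (32 * B) with hrB
  let y₀ (k : ℕ × ℕ × ℕ × ℕ) : ℤ := ⌈-(q₁ * k.1)⌉ + k.2.1
  let y₁ (k : ℕ × ℕ × ℕ × ℕ) : ℤ := ⌈-(q₂ * k.1)⌉ + k.2.2.1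
  let y₃ (k : ℕ × ℕ × ℕ × ℕ) : ℤ :=
    ⌈q₄ * k.1 - α₁ * (y₀ k + q₁ * k.1) - α₂ * (y₁ k + q₂ * k.1)⌉ + k.2.2.2
  let Φ (k : ℕ × ℕ × ℕ × ℕ) : Fin 4 → ℤ := ![y₀ k, y₁ k, (k.1 : ℤ), y₃ k]
  have hΦ : Function.Injective Φ := by
    rintro ⟨a, b, c, d⟩ ⟨a', b', c', d'⟩ h
    have h2 : (a : ℤ) = a' := by simpa [Φ] using congrFun h 2
    obtain rfl : a = a' := by exact_mod_cast h2
    have h0 : y₀ (a, b, c, d) = y₀ (a, b', c', d') := by simpa [Φ] using congrFun h 0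
    have h1 : y₁ (a, b, c, d) = y₁ (a, b', c', d') := by simpa [Φ] using congrFun h 1
    have h3 : y₃ (a, b, c, d) = y₃ (a, b', c', d') := by simpa [Φ] using congrFun h 3
    have hb : b = b' := by simpa [y₀] using h0
    have hc : c = c' := by simpa [y₁] using h1
    have hd : d = d' := by
      simp only [y₃] at h3
      rw [h0, h1] at h3
      simpa using h3
    rw [hb, hc, hd]
  set P : Finset (ℕ × ℕ × ℕ × ℕ) := Finset.range ⌊rD⌋₊ ×ˢ Finset.range ⌊rA⌋₊ ×ˢ
    Finset.range ⌊rA⌋₊ ×ˢ Finset.range ⌊rB⌋₊ with hP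
  set X : Finset (Fin 4 → ℤ) := P.image Φ with hX
  have ceil_aux : ∀ (z r : ℝ) (k : ℕ), k < ⌊r⌋₊ → 0 ≤ ((⌈z⌉ + k : ℤ) : ℝ) - z ∧
      ((⌈z⌉ + k : ℤ) : ℝ) - z ≤ r := by
    intro z r k hk
    have h1 : ((k + 1 : ℕ) : ℝ) ≤ r := (Nat.le_floor_iff' (by omega)).mp hk
    have h2 := Int.le_ceil z
    have h3 := Int.ceil_lt_add_one z
    push_cast at h1 ⊢
    have : (0 : ℝ) ≤ k := by positivity
    constructor <;> linarith
  have hXmem : ∀ y ∈ X, (0 ≤ (y 2 : ℝ) ∧ (y 2 : ℝ) ≤ rD) ∧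
      (0 ≤ y 0 + q₁ * y 2 ∧ y 0 + q₁ * y 2 ≤ rA) ∧
      (0 ≤ y 1 + q₂ * y 2 ∧ y 1 + q₂ * y 2 ≤ rA) ∧
      (0 ≤ (y 3 - q₄ * y 2) + α₁ * (y 0 + q₁ * y 2) + α₂ * (y 1 + q₂ * y 2) ∧
      (y 3 - q₄ * y 2) + α₁ * (y 0 + q₁ * y 2) + α₂ * (y 1 + q₂ * y 2) ≤ rB) := by
    intro y hy
    obtain ⟨k, hk, rfl⟩ := Finset.mem_image.mp hy
    simp only [hP, Finset.mem_product, Finset.mem_range] at hk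
    obtain ⟨ha, hb, hc, hd⟩ := hk
    have e0 := ceil_aux (-(q₁ * k.1)) rA k.2.1 hb
    have e1 := ceil_aux (-(q₂ * k.1)) rA k.2.2.1 hc
    have e3 := ceil_aux (q₄ * k.1 - α₁ * (y₀ k + q₁ * k.1) - α₂ * (y₁ k + q₂ * k.1)) rB
      k.2.2.2 hd
    have e2 : (k.1 : ℝ) ≤ rD := by
      have : ((k.1 + 1 : ℕ) : ℝ) ≤ rD := (Nat.le_floor_iff' (by omega)).mp ha
      push_cast at this; linarith
    change _ ∧ ((y₀ k : ℤ) : ℝ) - _ ≤ _ at e0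
    change _ ∧ ((y₁ k : ℤ) : ℝ) - _ ≤ _ at e1
    change _ ∧ ((y₃ k : ℤ) : ℝ) - _ ≤ _ at e3
    have e0' : 0 ≤ ((y₀ k : ℤ) : ℝ) - -(q₁ * k.1) := e0.1
    have e1' : 0 ≤ ((y₁ k : ℤ) : ℝ) - -(q₂ * k.1) := e1.1
    have e3' : 0 ≤ ((y₃ k : ℤ) : ℝ) -
      (q₄ * k.1 - α₁ * (y₀ k + q₁ * k.1) - α₂ * (y₁ k + q₂ * k.1)) := e3.1
    have v0 : Φ k 0 = y₀ k := rfl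
    have v1 : Φ k 1 = y₁ k := rfl
    have v2 : Φ k 2 = (k.1 : ℤ) := rfl
    have v3 : Φ k 3 = y₃ k := rfl
    rw [v0, v1, v2, v3]
    push_cast
    refine ⟨⟨by positivity, e2⟩, ⟨?_, ?_⟩, ⟨?_, ?_⟩, ?_, ?_⟩ <;> linarith
  have floor_aux : ∀ r : ℝ, 1 ≤ r → r / 2 ≤ (⌊r⌋₊ : ℝ) := by
    intro r hr
    have h1 := Nat.lt_floor_add_one r
    have h2 : (1 : ℝ) ≤ ⌊r⌋₊ := by exact_mod_cast (Nat.one_le_floor_iff r).mpr hr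
    linarith
  have hXcard : rD * rA ^ 2 * rB / 16 ≤ (X.card : ℝ) := by
    rw [hX, Finset.card_image_of_injective _ hΦ, hP]
    simp only [Finset.card_product, Finset.card_range]
    push_cast
    have d1 : 1 ≤ rD := by rw [hrD, le_div_iff₀ (by positivity)]; linarith
    have d2 : 1 ≤ rA := by rw [hrA, le_div_iff₀ (by positivity)]; linarith
    have d3 : 1 ≤ rB := by rw [hrB, le_div_iff₀ (by positivity)]; linarith
    calc rD * rA ^ 2 * rB / 16 = rD / 2 * (rA / 2 * (rA / 2 * (rB / 2))) := by ring
      _ ≤ _ := by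
        gcongr
        · exact floor_aux _ d1
        · exact floor_aux _ d2
        · exact floor_aux _ d2
        · exact floor_aux _ d3
  have hmain := card_mul_card_le_of_small_pairing (M := M) S X ?_ ?_ (T.card : ℝ) ?_
  · simp only [Fintype.card_fin] at hmain
    have h1 : rD * rA ^ 2 * rB / 16 * S.card ≤ 2 * T.card * (M : ℝ) ^ 4 :=
      (mul_le_mul_of_nonneg_right hXcard (by positivity)).trans hmain
    have h2 : rD * rA ^ 2 * rB / 16 = (M : ℝ) ^ 4 / (2 ^ 24 * (D * A ^ 2 * B)) := by
      rw [hrD, hrA, hrB]; field_simp; norm_num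
    rw [h2, div_mul_eq_mul_div, div_le_iff₀ (by positivity)] at h1
    have h3 : (0 : ℝ) < (M : ℝ) ^ 4 := by positivity
    refine le_of_mul_le_mul_left ?_ h3
    calc _ ≤ _ := h1
      _ = _ := by ring
  · intro n hn n' hn' h
    funext i
    have h1 := (ZMod.intCast_eq_intCast_iff_dvd_sub _ _ _).mp (h i)
    have h2 := hMS n hn i
    have h3 := hMS n' hn' i
    have h4 : |n' i - n i| < M := by
      have := abs_sub (n' i) (n i)
      omega
    have := Int.eq_zero_of_abs_lt_dvd h1 h4
    omega
  · intro n hn y hy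
    obtain ⟨s0, s1, s3, s2⟩ := hS n hn
    obtain ⟨⟨p1, p2⟩, ⟨p3, p4⟩, ⟨p5, p6⟩, p7, p8⟩ := hXmem y hy
    have hid : ∑ i, (n i : ℝ) * y i = -(y 2 * (q₁ * n 0 + q₂ * n 1 - n 2 - q₄ * n 3)) +
        (y 0 + q₁ * y 2) * (n 0 - α₁ * n 3) + (y 1 + q₂ * y 2) * (n 1 - α₂ * n 3) +
        ((y 3 - q₄ * y 2) + α₁ * (y 0 + q₁ * y 2) + α₂ * (y 1 + q₂ * y 2)) * n 3 := by
      rw [Fin.sum_univ_four]; ring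
    rw [hid]
    have mulb : ∀ u v r b : ℝ, 0 ≤ u → u ≤ r → |v| ≤ b → |u * v| ≤ r * b := by
      intro u v r b h0 h1 h2
      rw [abs_mul, abs_of_nonneg h0]
      exact mul_le_mul h1 h2 (abs_nonneg _) (h0.trans h1)
    have t1 := mulb _ _ _ _ p1 p2 s2
    have t2 := mulb _ _ _ _ p3 p4 s0
    have t3 := mulb _ _ _ _ p5 p6 s1
    have t4 := mulb _ _ _ _ p7 p8 s3
    have u1 : rD * D = M / 32 := by rw [hrD]; field_simp
    have u2 : rA * A = M / 32 := by rw [hrA]; field_simp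
    have u3 : rB * B = M / 32 := by rw [hrB]; field_simp
    rw [u1] at t1; rw [u2] at t2 t3; rw [u3] at t4
    rw [← abs_neg] at t1
    refine (abs_add_le _ _).trans ?_
    refine (add_le_add_left ((abs_add_le _ _).trans (add_le_add_left (abs_add_le _ _) _)) _).trans
      ?_
    linarith
  · intro r
    rcases (X.filter fun y => (fun i => ((y i : ℤ) : ZMod M)) = r).eq_empty_or_nonempty with
      he | ⟨y', hy'⟩
    · rw [he]; simp
    obtain ⟨hy'X, hy'r⟩ := Finset.mem_filter.mp hy'
    have hex : ∀ y ∈ X.filter (fun y => (fun i => ((y i : ℤ) : ZMod M)) = r),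
        ∃ l : Fin 4 → ℤ, ∀ i, y i - y' i = M * l i := by
      intro y hy
      obtain ⟨hyX, hyr⟩ := Finset.mem_filter.mp hy
      have : ∀ i, ∃ m : ℤ, y i - y' i = M * m := by
        intro i
        have h1 : ((y' i : ℤ) : ZMod M) = (y i : ℤ) := congrFun (hy'r.trans hyr.symm) i
        exact (ZMod.intCast_eq_intCast_iff_dvd_sub _ _ _).mp h1
      choose l hl using this
      exact ⟨l, hl⟩
    choose! l hl using hex
    have hle : (X.filter fun y => (fun i => ((y i : ℤ) : ZMod M)) = r).card ≤ T.card := by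
      refine Finset.card_le_card_of_injOn l ?_ ?_
      · intro y hy
        have hy := Finset.mem_coe.mp hy
        have hlr : ∀ i, (y i : ℝ) - y' i = M * l y i := fun i => by exact_mod_cast hl y hy i
        obtain ⟨⟨p1, p2⟩, ⟨p3, p4⟩, ⟨p5, p6⟩, p7, p8⟩ := hXmem y (Finset.mem_filter.mp hy).1
        obtain ⟨⟨p1', p2'⟩, ⟨p3', p4'⟩, ⟨p5', p6'⟩, p7', p8'⟩ := hXmem y' hy'X
        have scale : ∀ u v w R : ℝ, 0 < R → 0 ≤ u → u ≤ M / (32 * R) → 0 ≤ v →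
            v ≤ M / (32 * R) → u - v = M * w → |w| ≤ 1 / (16 * R) := by
          intro u v w R hR h1 h2 h3 h4 h5
          have h6 : |M * w| ≤ M / (32 * R) := by rw [← h5, abs_le]; constructor <;> linarith
          rw [abs_mul, abs_of_pos hM] at h6
          have h7 : M / (32 * R) = M * (1 / (32 * R)) := by ring
          rw [h7] at h6
          have h8 := le_of_mul_le_mul_left h6 hM
          refine h8.trans ?_
          gcongr
          norm_num
        have h0 := hlr 0
        have h1 := hlr 1
        have h2 := hlr 2
        have h3 := hlr 3
        refine hT _ ?_ ?_ ?_ ?_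
        · exact scale _ _ _ D hD p1 p2 p1' p2' h2
        · exact scale _ _ _ A hA p3 p4 p3' p4' (by linear_combination h0 + q₁ * h2)
        · exact scale _ _ _ A hA p5 p6 p5' p6' (by linear_combination h1 + q₂ * h2)
        · exact scale _ _ _ B hB p7 p8 p7' p8' (by
            linear_combination h3 - q₄ * h2 + α₁ * (h0 + q₁ * h2) + α₂ * (h1 + q₂ * h2))
      · intro y hy z hz hyz
        funext i
        have h1 := hl y (Finset.mem_coe.mp hy) i
        have h2 := hl z (Finset.mem_coe.mp hz) i
        rw [hyz, ← h2] at h1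
        linarith
    exact_mod_cast hle

theorem exists_abs_rpow_sub_rpow_le (p : ℝ) {L : ℝ} (hL : 1 ≤ L) :
    ∃ C : ℝ, 1 ≤ C ∧ ∀ a ∈ Set.Icc L⁻¹ L, ∀ b ∈ Set.Icc L⁻¹ L,
      |a ^ p - b ^ p| ≤ C * |a - b| := by
  have hL0 : 0 < L⁻¹ := by positivity
  have hcont : ContinuousOn (fun t : ℝ => p * t ^ (p - 1)) (Set.Icc L⁻¹ L) := by
    refine continuousOn_const.mul (continuousOn_id.rpow_const fun t ht => Or.inl ?_)
    exact (hL0.trans_le ht.1).ne'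
  obtain ⟨C, hC⟩ := isCompact_Icc.exists_bound_of_continuousOn hcont
  refine ⟨max C 1, le_max_right _ _, fun a ha b hb => ?_⟩
  have := (convex_Icc L⁻¹ L).norm_image_sub_le_of_norm_hasDerivWithin_le (f := fun t => t ^ p)
    (fun t ht => (Real.hasDerivAt_rpow_const (p := p)
      (Or.inl (hL0.trans_le ht.1).ne')).hasDerivWithinAt)
    (fun t ht => (hC t ht).trans (le_max_left C 1)) hb ha
  simpa [Real.norm_eq_abs] using this

theorem exists_abs_rpow_sub_taylor_le (p : ℝ) {L : ℝ} (hL : 1 ≤ L) :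
    ∃ C : ℝ, 1 ≤ C ∧ ∀ a ∈ Set.Icc L⁻¹ L, ∀ b ∈ Set.Icc L⁻¹ L,
      |a ^ p - b ^ p - p * b ^ (p - 1) * (a - b)| ≤ C * (a - b) ^ 2 := by
  have hL0 : 0 < L⁻¹ := by positivity
  obtain ⟨C, hC1, hC⟩ := exists_abs_rpow_sub_rpow_le (p - 1) hL
  refine ⟨max (|p| * C) 1, le_max_right _ _, fun a ha b hb => ?_⟩
  have hsub : Set.uIcc b a ⊆ Set.Icc L⁻¹ L := Set.uIcc_subset_Icc hb ha
  have := (convex_uIcc b a).norm_image_sub_le_of_norm_hasDerivWithin_le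
    (f := fun t => t ^ p - p * b ^ (p - 1) * t)
    (f' := fun t => p * t ^ (p - 1) - p * b ^ (p - 1) * 1) (C := |p| * C * |a - b|)
    (fun t ht => (((Real.hasDerivAt_rpow_const (p := p)
      (Or.inl (hL0.trans_le (hsub ht).1).ne'))).sub
        ((hasDerivAt_id t).const_mul _)).hasDerivWithinAt)
    (fun t ht => by
      have h1 := hC t (hsub ht) b hb
      have h2 : |t - b| ≤ |a - b| := Set.abs_sub_left_of_mem_uIcc ht
      rw [mul_one, ← mul_sub, Real.norm_eq_abs, abs_mul, mul_assoc]
      gcongr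
      exact h1.trans (by gcongr)) Set.left_mem_uIcc Set.right_mem_uIcc
  rw [Real.norm_eq_abs, Real.norm_eq_abs, mul_assoc (|p| * C), abs_mul_abs_self, ← sq] at this
  have h3 : a ^ p - b ^ p - p * b ^ (p - 1) * (a - b) =
      a ^ p - p * b ^ (p - 1) * a - (b ^ p - p * b ^ (p - 1) * b) := by ring
  rw [h3]
  exact this.trans (by gcongr; exact le_max_left _ _)

theorem exists_abs_sub_le_abs_rpow_sub_rpow {p : ℝ} (hp : p ≠ 0) {L : ℝ} (hL : 1 ≤ L) :
    ∃ C : ℝ, 1 ≤ C ∧ ∀ a ∈ Set.Icc L⁻¹ L, ∀ b ∈ Set.Icc L⁻¹ L,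
      |a - b| ≤ C * |a ^ p - b ^ p| := by
  have hL0 : 0 < L⁻¹ := by positivity
  obtain ⟨C, hC1, hC⟩ := exists_abs_rpow_sub_rpow_le p⁻¹
    (L := L ^ |p|) (Real.one_le_rpow hL (abs_nonneg p))
  have hmem : ∀ a ∈ Set.Icc L⁻¹ L, a ^ p ∈ Set.Icc (L ^ |p|)⁻¹ (L ^ |p|) := by
    intro a ha
    have ha0 : 0 < a := hL0.trans_le ha.1
    have hLp : (0 : ℝ) < L := by linarith
    rw [← Real.inv_rpow hLp.le]
    have hinv : a⁻¹ ∈ Set.Icc L⁻¹ L := ⟨inv_anti₀ ha0 ha.2, by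
      simpa using inv_anti₀ hL0 ha.1⟩
    rcases le_total 0 p with h | h
    · rw [abs_of_nonneg h]
      exact ⟨Real.rpow_le_rpow hL0.le ha.1 h, Real.rpow_le_rpow ha0.le ha.2 h⟩
    · rw [abs_of_nonpos h]
      have : a ^ p = a⁻¹ ^ (-p) := by rw [Real.inv_rpow ha0.le, Real.rpow_neg ha0.le, inv_inv]
      rw [this]
      exact ⟨Real.rpow_le_rpow hL0.le hinv.1 (by linarith),
        Real.rpow_le_rpow (by positivity) hinv.2 (by linarith)⟩
  refine ⟨C, hC1, fun a ha b hb => ?_⟩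
  have := hC _ (hmem a ha) _ (hmem b hb)
  rwa [Real.rpow_rpow_inv (hL0.trans_le ha.1).le hp,
    Real.rpow_rpow_inv (hL0.trans_le hb.1).le hp] at this

theorem rpow_mem_Icc {L a p : ℝ} (hL : 1 ≤ L) (hp : 0 ≤ p) (ha : a ∈ Set.Icc L⁻¹ L) :
    a ^ p ∈ Set.Icc (L ^ p)⁻¹ (L ^ p) := by
  have hL0 : 0 < L⁻¹ := by positivity
  rw [← Real.inv_rpow (by linarith)]
  exact ⟨Real.rpow_le_rpow hL0.le ha.1 hp, Real.rpow_le_rpow (hL0.le.trans ha.1) ha.2 hp⟩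

theorem div_mem_Icc {L a b : ℝ} (hL : 1 ≤ L) (ha : a ∈ Set.Icc L⁻¹ L)
    (hb : b ∈ Set.Icc L⁻¹ L) : a / b ∈ Set.Icc (L ^ 2)⁻¹ (L ^ 2) := by
  have hL0 : 0 < L⁻¹ := by positivity
  have hLp : 0 < L := by linarith
  have ha0 : 0 < a := hL0.trans_le ha.1
  have hb0 : 0 < b := hL0.trans_le hb.1
  constructor
  · calc (L ^ 2)⁻¹ = L⁻¹ / L := by field_simp
      _ ≤ a / b := div_le_div₀ ha0.le ha.1 hb0 hb.2
  · calc a / b ≤ L / L⁻¹ := div_le_div₀ hLp.le ha.2 hL0 hb.1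
      _ = L ^ 2 := by field_simp

/-- Points of a cap of the cone `x₁ᶜ + x₂ᶜ = x₃ᶜ + 1` lie close to the tangent plane. -/
theorem exists_tangent_plane_bound {c L κ : ℝ} (hc : 1 < c) (hL : 1 ≤ L) (hκ : 0 ≤ κ) :
    ∃ C : ℝ, 1 ≤ C ∧ ∀ ρ : ℝ, 0 ≤ ρ → ρ ≤ 1 →
      ∀ x₁ ∈ Set.Icc L⁻¹ L, ∀ x₂ ∈ Set.Icc L⁻¹ L, ∀ x₃ ∈ Set.Icc L⁻¹ L,
      ∀ a₁ ∈ Set.Icc L⁻¹ L, ∀ a₂ ∈ Set.Icc L⁻¹ L, ∀ a₃ ∈ Set.Icc L⁻¹ L,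
      |x₁ - a₁| ≤ ρ → |x₂ - a₂| ≤ ρ →
      |x₁ ^ c + x₂ ^ c - x₃ ^ c - 1| ≤ κ * ρ ^ 2 → |a₁ ^ c + a₂ ^ c - a₃ ^ c - 1| ≤ κ * ρ ^ 2 →
      |(a₁ / a₃) ^ (c - 1) * x₁ + (a₂ / a₃) ^ (c - 1) * x₂ - x₃ - (1 / a₃) ^ (c - 1)| ≤
        C * ρ ^ 2 := by
  obtain ⟨C₁, hC₁, h₁⟩ := exists_abs_rpow_sub_rpow_le c hL
  obtain ⟨C₂, hC₂, h₂⟩ := exists_abs_rpow_sub_taylor_le c hL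
  obtain ⟨C₃, hC₃, h₃⟩ := exists_abs_sub_le_abs_rpow_sub_rpow (p := c) (by linarith) hL
  set C₄ := C₃ * (2 * C₁ + 2 * κ) with hC₄
  have hLc : 1 ≤ L ^ (c - 1) := Real.one_le_rpow hL (by linarith)
  refine ⟨L ^ (c - 1) * (3 * κ + C₂ * (2 + C₄ ^ 2)), ?_, ?_⟩
  · have : 1 ≤ 3 * κ + C₂ * (2 + C₄ ^ 2) := by nlinarith [sq_nonneg C₄]
    nlinarith
  intro ρ hρ hρ1 x₁ hx₁ x₂ hx₂ x₃ hx₃ a₁ ha₁ a₂ ha₂ a₃ ha₃ hd₁ hd₂ hx ha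
  have hL0 : 0 < L⁻¹ := by positivity
  have pa₁ : 0 < a₁ := hL0.trans_le ha₁.1
  have pa₂ : 0 < a₂ := hL0.trans_le ha₂.1
  have pa₃ : 0 < a₃ := hL0.trans_le ha₃.1
  have hρ2 : ρ ^ 2 ≤ ρ := by nlinarith
  have hd₃ : |x₃ - a₃| ≤ C₄ * ρ := by
    have e1 : |x₁ ^ c - a₁ ^ c| ≤ C₁ * ρ := (h₁ _ hx₁ _ ha₁).trans (by gcongr)
    have e2 : |x₂ ^ c - a₂ ^ c| ≤ C₁ * ρ := (h₁ _ hx₂ _ ha₂).trans (by gcongr)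
    have e3 : |x₃ ^ c - a₃ ^ c| ≤ (2 * C₁ + 2 * κ) * ρ := by
      have : κ * ρ ^ 2 ≤ κ * ρ := by gcongr
      rw [abs_le] at e1 e2 hx ha ⊢
      constructor <;> linarith [e1.1, e1.2, e2.1, e2.2, hx.1, hx.2, ha.1, ha.2]
    calc |x₃ - a₃| ≤ C₃ * |x₃ ^ c - a₃ ^ c| := h₃ _ hx₃ _ ha₃
      _ ≤ C₃ * ((2 * C₁ + 2 * κ) * ρ) := by gcongr
      _ = C₄ * ρ := by rw [hC₄]; ring
  have sqb : ∀ u b : ℝ, |u| ≤ b → u ^ 2 ≤ b ^ 2 := fun u b h => by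
    rw [← sq_abs]; gcongr
  have t₁ : |x₁ ^ c - a₁ ^ c - c * a₁ ^ (c - 1) * (x₁ - a₁)| ≤ C₂ * ρ ^ 2 :=
    (h₂ _ hx₁ _ ha₁).trans (mul_le_mul_of_nonneg_left (sqb _ _ hd₁) (by linarith))
  have t₂ : |x₂ ^ c - a₂ ^ c - c * a₂ ^ (c - 1) * (x₂ - a₂)| ≤ C₂ * ρ ^ 2 :=
    (h₂ _ hx₂ _ ha₂).trans (mul_le_mul_of_nonneg_left (sqb _ _ hd₂) (by linarith))
  have t₃ : |x₃ ^ c - a₃ ^ c - c * a₃ ^ (c - 1) * (x₃ - a₃)| ≤ C₂ * (C₄ ^ 2 * ρ ^ 2) :=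
    (h₂ _ hx₃ _ ha₃).trans (by gcongr; rw [← mul_pow]; exact sqb _ _ hd₃)
  have hpow : ∀ a : ℝ, 0 < a → a ^ (c - 1) * a = a ^ c := fun a h => by
    rw [Real.rpow_sub_one h.ne']; field_simp
  set V := a₁ ^ (c - 1) * x₁ + a₂ ^ (c - 1) * x₂ - a₃ ^ (c - 1) * x₃ - 1 with hV
  have hVid : c * (V - (a₁ ^ c + a₂ ^ c - a₃ ^ c - 1)) =
      c * a₁ ^ (c - 1) * (x₁ - a₁) + c * a₂ ^ (c - 1) * (x₂ - a₂) -
        c * a₃ ^ (c - 1) * (x₃ - a₃) := by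
    rw [hV, ← hpow a₁ pa₁, ← hpow a₂ pa₂, ← hpow a₃ pa₃]; ring
  have hVb : |c * (V - (a₁ ^ c + a₂ ^ c - a₃ ^ c - 1))| ≤
      (2 * κ + C₂ * (2 + C₄ ^ 2)) * ρ ^ 2 := by
    rw [hVid]
    rw [abs_le] at t₁ t₂ t₃ hx ha ⊢
    constructor <;> linarith [t₁.1, t₁.2, t₂.1, t₂.2, t₃.1, t₃.2, hx.1, hx.2, ha.1, ha.2]
  have hVb' : |V| ≤ (3 * κ + C₂ * (2 + C₄ ^ 2)) * ρ ^ 2 := by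
    rw [abs_mul, abs_of_pos (by linarith)] at hVb
    have h5 : |V - (a₁ ^ c + a₂ ^ c - a₃ ^ c - 1)| ≤
        (2 * κ + C₂ * (2 + C₄ ^ 2)) * ρ ^ 2 :=
      (le_mul_of_one_le_left (abs_nonneg _) hc.le).trans hVb
    rw [abs_le] at h5 ha ⊢
    constructor <;> linarith [h5.1, h5.2, ha.1, ha.2]
  have hfin : (a₁ / a₃) ^ (c - 1) * x₁ + (a₂ / a₃) ^ (c - 1) * x₂ - x₃ - (1 / a₃) ^ (c - 1) =
      (a₃ ^ (c - 1))⁻¹ * V := by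
    rw [Real.div_rpow pa₁.le pa₃.le, Real.div_rpow pa₂.le pa₃.le,
      Real.div_rpow zero_le_one pa₃.le, Real.one_rpow, hV]
    have : 0 < a₃ ^ (c - 1) := by positivity
    field_simp
  have hinv : (a₃ ^ (c - 1))⁻¹ ≤ L ^ (c - 1) := by
    have := (rpow_mem_Icc hL (p := c - 1) (by linarith) ha₃).1
    simpa using inv_anti₀ (by positivity) this
  rw [hfin, abs_mul, abs_of_pos (by positivity), mul_assoc]
  gcongr

set_option maxHeartbeats 800000 in
/-- Vectors close to the normal of the cone `x₁ᶜ + x₂ᶜ = x₃ᶜ + 1` lie close to the dual cone, whose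
exponent is `c / (c - 1)`, and determine the point of tangency. -/
theorem exists_dual_cone_bound {c L : ℝ} (hc : 1 < c) (hL : 1 ≤ L) :
    ∃ e₀ L' C : ℝ, 0 < e₀ ∧ 1 ≤ L' ∧ 1 ≤ C ∧ ∀ e g ε : ℝ, g ≤ e → e ≤ e₀ →
      ∀ a₁ ∈ Set.Icc L⁻¹ L, ∀ a₂ ∈ Set.Icc L⁻¹ L, ∀ a₃ ∈ Set.Icc L⁻¹ L, ∀ z₁ z₂ z₄ : ℝ,
      |z₁ - (a₁ / a₃) ^ (c - 1)| ≤ e → |z₂ - (a₂ / a₃) ^ (c - 1)| ≤ e →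
      |a₁ * (z₁ - (a₁ / a₃) ^ (c - 1)) + a₂ * (z₂ - (a₂ / a₃) ^ (c - 1)) -
        (z₄ - (1 / a₃) ^ (c - 1))| ≤ g →
      |a₁ ^ c + a₂ ^ c - a₃ ^ c - 1| ≤ ε →
      z₁ ∈ Set.Icc L'⁻¹ L' ∧ z₂ ∈ Set.Icc L'⁻¹ L' ∧ z₄ ∈ Set.Icc L'⁻¹ L' ∧
      |z₁ ^ (c / (c - 1)) + z₂ ^ (c / (c - 1)) - 1 - z₄ ^ (c / (c - 1))| ≤
        C * (ε + g + e ^ 2) ∧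
      |a₁ - (z₁ / z₄) ^ (c - 1)⁻¹| ≤ C * e ∧ |a₂ - (z₂ / z₄) ^ (c - 1)⁻¹| ≤ C * e := by
  have hc1 : 0 < c - 1 := by linarith
  set c' := c / (c - 1) with hc'
  have hc'1 : 1 < c' := by rw [hc', lt_div_iff₀ hc1]; linarith
  have hL2 : 1 ≤ L ^ 2 := one_le_pow₀ hL
  set M := (L ^ 2) ^ (c - 1) with hM
  have hM1 : 1 ≤ M := Real.one_le_rpow hL2 hc1.le
  have hM2 : 1 ≤ 2 * M := by linarith
  obtain ⟨C₂, hC₂, h₂⟩ := exists_abs_rpow_sub_taylor_le c' hM2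
  obtain ⟨C₁, hC₁, h₁⟩ := exists_abs_rpow_sub_rpow_le (c - 1)⁻¹ (L := (2 * M) ^ 2)
    (one_le_pow₀ hM2)
  set b := 2 * L + 1 with hb
  have hb1 : 1 ≤ b := by linarith
  have hMb : 1 ≤ M * b := by nlinarith
  set Ca := L ^ c with hCa
  have hCa1 : 1 ≤ Ca := Real.one_le_rpow hL (by linarith)
  set Ct := C₂ * (2 + b ^ 2) with hCt
  set Cd := C₁ * (M + M * b) * (2 * M * M) with hCd
  have hCt0 : 0 ≤ Ct := by positivity
  have hCd0 : 0 ≤ Cd := by positivity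
  refine ⟨1 / (2 * M * b), 2 * M, Ca + c' * L + Ct + Cd, by positivity, hM2, ?_, ?_⟩
  · have : 0 ≤ c' * L := by positivity
    linarith
  intro e g ε hge he a₁ ha₁ a₂ ha₂ a₃ ha₃ z₁ z₂ z₄ hz₁ hz₂ hz₄ hε
  have hL0 : 0 < L⁻¹ := by positivity
  have pa₁ : 0 < a₁ := hL0.trans_le ha₁.1
  have pa₂ : 0 < a₂ := hL0.trans_le ha₂.1
  have pa₃ : 0 < a₃ := hL0.trans_le ha₃.1
  have he0 : 0 ≤ e := (abs_nonneg _).trans hz₁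
  have hg0 : 0 ≤ g := (abs_nonneg _).trans hz₄
  have hε0 : 0 ≤ ε := (abs_nonneg _).trans hε
  have h1mem : (1 : ℝ) ∈ Set.Icc L⁻¹ L := ⟨inv_le_one_of_one_le₀ hL, hL⟩
  have hq₁ := rpow_mem_Icc hL2 hc1.le (div_mem_Icc hL ha₁ ha₃)
  have hq₂ := rpow_mem_Icc hL2 hc1.le (div_mem_Icc hL ha₂ ha₃)
  have hq₄ := rpow_mem_Icc hL2 hc1.le (div_mem_Icc hL h1mem ha₃)
  set q₁ := (a₁ / a₃) ^ (c - 1) with hq₁d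
  set q₂ := (a₂ / a₃) ^ (c - 1) with hq₂d
  set q₄ := (1 / a₃) ^ (c - 1) with hq₄d
  rw [← hM] at hq₁ hq₂ hq₄
  have hz₄' : |z₄ - q₄| ≤ b * e := by
    have e1 : |a₁ * (z₁ - q₁)| ≤ L * e := by
      rw [abs_mul, abs_of_pos pa₁]; exact mul_le_mul ha₁.2 hz₁ (abs_nonneg _) (by linarith)
    have e2 : |a₂ * (z₂ - q₂)| ≤ L * e := by
      rw [abs_mul, abs_of_pos pa₂]; exact mul_le_mul ha₂.2 hz₂ (abs_nonneg _) (by linarith)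
    rw [hb]
    rw [abs_le] at e1 e2 hz₄ ⊢
    constructor <;> linarith [e1.1, e1.2, e2.1, e2.2, hz₄.1, hz₄.2]
  have hbe : b * e ≤ (2 * M)⁻¹ := by
    calc b * e ≤ b * (1 / (2 * M * b)) := by gcongr
      _ = (2 * M)⁻¹ := by field_simp
  have hee : e ≤ (2 * M)⁻¹ := by nlinarith
  have hhalf : M⁻¹ = (2 * M)⁻¹ + (2 * M)⁻¹ := by field_simp; norm_num
  have hinvM : (2 * M)⁻¹ ≤ M := (inv_le_one_of_one_le₀ hM2).trans hM1
  have hmem : ∀ z q : ℝ, q ∈ Set.Icc M⁻¹ M → |z - q| ≤ (2 * M)⁻¹ →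
      z ∈ Set.Icc (2 * M)⁻¹ (2 * M) := by
    intro z q hq h
    rw [abs_le] at h
    exact ⟨by linarith [hq.1], by linarith [hq.2]⟩
  have hmq : ∀ q : ℝ, q ∈ Set.Icc M⁻¹ M → q ∈ Set.Icc (2 * M)⁻¹ (2 * M) := fun q hq =>
    hmem q q hq (by simp; linarith)
  have mz₁ := hmem z₁ q₁ hq₁ (hz₁.trans hee)
  have mz₂ := hmem z₂ q₂ hq₂ (hz₂.trans hee)
  have mz₄ := hmem z₄ q₄ hq₄ (hz₄'.trans hbe)
  have hM0 : 0 < (2 * M)⁻¹ := by positivity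
  have pz₄ : 0 < z₄ := hM0.trans_le mz₄.1
  have pq₄ : 0 < q₄ := hM0.trans_le (hmq _ hq₄).1
  have hCe : ∀ X : ℝ, 0 ≤ X → X ≤ Ca + c' * L + Ct + Cd → X * e ≤
      (Ca + c' * L + Ct + Cd) * e := fun X _ h => by gcongr
  have hcL : 0 ≤ c' * L := by positivity
  have loc : ∀ z q a : ℝ, z ∈ Set.Icc (2 * M)⁻¹ (2 * M) → q ∈ Set.Icc M⁻¹ M → |z - q| ≤ e →
      0 < a → q = (a / a₃) ^ (c - 1) →
      |a - (z / z₄) ^ (c - 1)⁻¹| ≤ (Ca + c' * L + Ct + Cd) * e := by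
    intro z q a mz mq hzq pa hqa
    have e1 : (q / q₄) ^ (c - 1)⁻¹ = a := by
      rw [hqa, hq₄d, ← Real.div_rpow (by positivity) (by positivity),
        Real.rpow_rpow_inv (by positivity) hc1.ne']
      field_simp
    have e2 := h₁ _ (div_mem_Icc hM2 (hmq _ mq) (hmq _ hq₄)) _ (div_mem_Icc hM2 mz mz₄)
    rw [e1] at e2
    refine e2.trans (le_trans ?_ (hCe Cd hCd0 (by linarith)))
    have e3 : q / q₄ - z / z₄ = ((q - z) * q₄ + q * (z₄ - q₄)) * (z₄⁻¹ * q₄⁻¹) := by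
      field_simp; ring
    have e4 : |(q - z) * q₄ + q * (z₄ - q₄)| ≤ (M + M * b) * e := by
      refine (abs_add_le _ _).trans ?_
      rw [abs_mul, abs_mul, abs_sub_comm q z, abs_of_pos pq₄,
        abs_of_pos (hM0.trans_le (hmq _ mq).1)]
      have := mul_le_mul hzq hq₄.2 pq₄.le he0
      have := mul_le_mul mq.2 hz₄' (abs_nonneg _) (by linarith)
      linarith
    have e5 : z₄⁻¹ ≤ 2 * M := by simpa using inv_anti₀ hM0 mz₄.1
    have e6 : q₄⁻¹ ≤ M := by simpa using inv_anti₀ (by positivity) hq₄.1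
    have e7 : |q / q₄ - z / z₄| ≤ (M + M * b) * e * (2 * M * M) := by
      rw [e3, abs_mul, abs_of_pos (a := z₄⁻¹ * q₄⁻¹) (by positivity)]
      gcongr
    calc C₁ * |q / q₄ - z / z₄| ≤ C₁ * ((M + M * b) * e * (2 * M * M)) := by gcongr
      _ = Cd * e := by rw [hCd]; ring
  refine ⟨mz₁, mz₂, mz₄, ?_, loc z₁ q₁ a₁ mz₁ hq₁ hz₁ pa₁ rfl, loc z₂ q₂ a₂ mz₂ hq₂ hz₂ pa₂ rfl⟩
  have sqb : ∀ u b : ℝ, |u| ≤ b → u ^ 2 ≤ b ^ 2 := fun u b h => by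
    rw [← sq_abs]; gcongr
  have t₁ := (h₂ _ mz₁ _ (hmq _ hq₁)).trans
    (mul_le_mul_of_nonneg_left (sqb _ _ hz₁) (by linarith))
  have t₂ := (h₂ _ mz₂ _ (hmq _ hq₂)).trans
    (mul_le_mul_of_nonneg_left (sqb _ _ hz₂) (by linarith))
  have t₄ := (h₂ _ mz₄ _ (hmq _ hq₄)).trans
    (mul_le_mul_of_nonneg_left (sqb _ _ hz₄') (by linarith))
  have pw : ∀ a : ℝ, 0 < a → (a ^ (c - 1)) ^ c' = a ^ c ∧ (a ^ (c - 1)) ^ (c' - 1) = a := by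
    intro a pa
    rw [← Real.rpow_mul pa.le, ← Real.rpow_mul pa.le]
    have e1 : (c - 1) * c' = c := by rw [hc']; field_simp
    have e2 : (c - 1) * (c' - 1) = 1 := by linarith
    rw [e1, e2, Real.rpow_one]
    exact ⟨rfl, rfl⟩
  obtain ⟨u₁, v₁⟩ := pw _ (div_pos pa₁ pa₃)
  obtain ⟨u₂, v₂⟩ := pw _ (div_pos pa₂ pa₃)
  obtain ⟨u₄, v₄⟩ := pw _ (div_pos one_pos pa₃)
  rw [u₁, v₁] at t₁
  rw [u₂, v₂] at t₂
  rw [u₄, v₄] at t₄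
  have hmain : (a₁ / a₃) ^ c + (a₂ / a₃) ^ c - 1 - (1 / a₃) ^ c =
      (a₃ ^ c)⁻¹ * (a₁ ^ c + a₂ ^ c - a₃ ^ c - 1) := by
    rw [Real.div_rpow pa₁.le pa₃.le, Real.div_rpow pa₂.le pa₃.le,
      Real.div_rpow zero_le_one pa₃.le, Real.one_rpow]
    have : 0 < a₃ ^ c := by positivity
    field_simp
  have m₁ : |(a₁ / a₃) ^ c + (a₂ / a₃) ^ c - 1 - (1 / a₃) ^ c| ≤ Ca * ε := by
    have := (rpow_mem_Icc hL (p := c) (by linarith) ha₃).1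
    have hinv : (a₃ ^ c)⁻¹ ≤ L ^ c := by simpa using inv_anti₀ (by positivity) this
    rw [hmain, abs_mul, abs_of_pos (by positivity)]
    gcongr
  have m₂ : |c' * (a₁ / a₃) * (z₁ - q₁) + c' * (a₂ / a₃) * (z₂ - q₂) -
      c' * (1 / a₃) * (z₄ - q₄)| ≤ c' * L * g := by
    have : c' * (a₁ / a₃) * (z₁ - q₁) + c' * (a₂ / a₃) * (z₂ - q₂) -
      c' * (1 / a₃) * (z₄ - q₄) = c' * a₃⁻¹ * (a₁ * (z₁ - q₁) + a₂ * (z₂ - q₂) -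
        (z₄ - q₄)) := by field_simp
    rw [this, abs_mul, abs_of_pos (a := c' * a₃⁻¹) (by positivity)]
    have hinv : a₃⁻¹ ≤ L := by simpa using inv_anti₀ hL0 ha₃.1
    gcongr
  have hCtid : Ct * e ^ 2 = C₂ * e ^ 2 + C₂ * e ^ 2 + C₂ * (b * e) ^ 2 := by rw [hCt]; ring
  have fin : |z₁ ^ c' + z₂ ^ c' - 1 - z₄ ^ c'| ≤ Ca * ε + c' * L * g + Ct * e ^ 2 := by
    rw [hCtid]
    rw [abs_le] at t₁ t₂ t₄ m₁ m₂ ⊢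
    constructor <;> linarith [t₁.1, t₁.2, t₂.1, t₂.2, t₄.1, t₄.2, m₁.1, m₁.2, m₂.1, m₂.2]
  refine fin.trans ?_
  have w₁ : Ca * ε ≤ (Ca + c' * L + Ct + Cd) * ε := by gcongr; linarith
  have w₂ : c' * L * g ≤ (Ca + c' * L + Ct + Cd) * g := by gcongr; linarith
  have w₃ : Ct * e ^ 2 ≤ (Ca + c' * L + Ct + Cd) * e ^ 2 := by gcongr; linarith
  linarith

/-- The integer points of size about `Y` lying within relative distance `δ / Y` of the cone
`n₀ ^ c + n₁ ^ c = n₂ ^ c + n₃ ^ c`. -/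
def NearCone (c K Y δ : ℝ) (n : Fin 4 → ℤ) : Prop :=
  (∀ i, Y ≤ K * n i ∧ (n i : ℝ) ≤ K * Y) ∧
    |(n 0 : ℝ) ^ c + (n 1 : ℝ) ^ c - (n 2 : ℝ) ^ c - (n 3 : ℝ) ^ c| ≤ δ * Y ^ (c - 1)

/-- The number of integer points near the cone is `O(Y ^ β + δ Y ^ 3)`, for every exponent
`c > 1`. -/
def EnergyBound (β : ℝ) : Prop :=
  ∀ c K : ℝ, 1 < c → 1 ≤ K → ∃ C : ℝ, 0 < C ∧ ∀ Y δ : ℝ, 1 ≤ Y → 0 < δ →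
    ∀ S : Finset (Fin 4 → ℤ), (∀ n ∈ S, NearCone c K Y δ n) →
      (S.card : ℝ) ≤ C * (Y ^ β + δ * Y ^ 3)

/-- The lattice points dual to the piece of the cone of angular width `ρ` around the
direction `(a₁, a₂, a₃, 1)`. -/
def DualPoint (c M Y ρ a₁ a₂ a₃ : ℝ) (m : Fin 4 → ℤ) : Prop :=
  0 < m 2 ∧ (m 2 : ℝ) ≤ 1 / (16 * (M * ρ ^ 2 * Y)) ∧
  |m 0 - (a₁ / a₃) ^ (c - 1) * m 2| ≤ 1 / (16 * (M * ρ * Y)) ∧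
  |m 1 - (a₂ / a₃) ^ (c - 1) * m 2| ≤ 1 / (16 * (M * ρ * Y)) ∧
  |a₁ * (m 0 - (a₁ / a₃) ^ (c - 1) * m 2) + a₂ * (m 1 - (a₂ / a₃) ^ (c - 1) * m 2) -
    (m 3 - (1 / a₃) ^ (c - 1) * m 2)| ≤ 1 / (16 * (M * Y))

theorem card_le_of_dualPoint {c M Y ρ a₁ a₂ a₃ : ℝ} (hM : 1 ≤ M) (hY : 1 ≤ Y) (hρ : 0 < ρ)
    (hρY : 1 ≤ ρ * Y) (S T : Finset (Fin 4 → ℤ))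
    (hS : ∀ n ∈ S, |n 0 - a₁ * n 3| ≤ M * ρ * Y ∧ |n 1 - a₂ * n 3| ≤ M * ρ * Y ∧
      |(n 3 : ℝ)| ≤ M * Y ∧
      |(a₁ / a₃) ^ (c - 1) * n 0 + (a₂ / a₃) ^ (c - 1) * n 1 - n 2 - (1 / a₃) ^ (c - 1) * n 3| ≤
        M * ρ ^ 2 * Y)
    (hT : ∀ m, DualPoint c M Y ρ a₁ a₂ a₃ m → m ∈ T) :
    (S.card : ℝ) ≤ 2 ^ 25 * M ^ 4 * ρ ^ 4 * Y ^ 4 * (1 + 2 * T.card) := by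
  classical
  have hA : 1 ≤ M * ρ * Y := by nlinarith
  have hB : 1 ≤ M * Y := by nlinarith
  have hD : 0 < M * ρ ^ 2 * Y := by positivity
  have hA' : 1 / (16 * (M * ρ * Y)) < 1 := by
    rw [div_lt_one (by positivity)]; linarith
  have hB' : 1 / (16 * (M * Y)) < 1 := by
    rw [div_lt_one (by positivity)]; linarith
  let pos (m : Fin 4 → ℤ) : Fin 4 → ℤ := ![-m 0, -m 1, m 2, m 3]
  let neg (m : Fin 4 → ℤ) : Fin 4 → ℤ := ![m 0, m 1, -m 2, -m 3]
  have hcard : ((({0} ∪ (T.image pos ∪ T.image neg)) : Finset (Fin 4 → ℤ)).card : ℝ) ≤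
      1 + 2 * T.card := by
    have h1 := card_union_le ({0} : Finset (Fin 4 → ℤ)) (T.image pos ∪ T.image neg)
    have h2 := card_union_le (T.image pos) (T.image neg)
    have h3 : (T.image pos).card ≤ T.card := card_image_le
    have h4 : (T.image neg).card ≤ T.card := card_image_le
    rw [card_singleton] at h1
    exact_mod_cast (by omega : ({0} ∪ (T.image pos ∪ T.image neg)).card ≤ 1 + 2 * T.card)
  have key := card_le_mul_card_dual ((a₁ / a₃) ^ (c - 1)) ((a₂ / a₃) ^ (c - 1))
    ((1 / a₃) ^ (c - 1)) a₁ a₂ (by linarith : 0 < M * ρ * Y) (by linarith : 0 < M * Y) hD S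
    ({0} ∪ (T.image pos ∪ T.image neg)) hS ?_
  · refine key.trans ?_
    calc _ = 2 ^ 25 * M ^ 4 * ρ ^ 4 * Y ^ 4 *
          ((({0} ∪ (T.image pos ∪ T.image neg)) : Finset (Fin 4 → ℤ)).card : ℝ) := by ring
      _ ≤ _ := by gcongr
  · intro l h2 h0 h1 h3
    simp only [mem_union, mem_singleton, mem_image]
    rcases lt_trichotomy (l 2) 0 with hl | hl | hl
    · refine Or.inr (Or.inr ⟨![l 0, l 1, -l 2, -l 3], hT _ ⟨?_, ?_, ?_, ?_, ?_⟩, ?_⟩)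
      · simpa using hl
      · have hl' : (l 2 : ℝ) < 0 := by exact_mod_cast hl
        rw [abs_of_neg hl'] at h2
        simpa using h2
      · simpa using h0
      · simpa using h1
      · convert h3 using 2
        simp; ring
      · ext i; fin_cases i <;> simp [neg]
    · left
      simp only [hl, Int.cast_zero, mul_zero, add_zero, sub_zero] at h0 h1 h3
      have h0' : l 0 = 0 := Int.abs_lt_one_iff.mp (by exact_mod_cast h0.trans_lt hA')
      have h1' : l 1 = 0 := Int.abs_lt_one_iff.mp (by exact_mod_cast h1.trans_lt hA')
      simp only [h0', h1', Int.cast_zero, mul_zero, add_zero] at h3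
      have h3' : l 3 = 0 := Int.abs_lt_one_iff.mp (by exact_mod_cast h3.trans_lt hB')
      ext i; fin_cases i <;> simp [h0', h1', h3', hl]
    · refine Or.inr (Or.inl ⟨![-l 0, -l 1, l 2, l 3], hT _ ⟨?_, ?_, ?_, ?_, ?_⟩, ?_⟩)
      · simpa using hl
      · exact (le_abs_self _).trans h2
      · rw [← abs_neg] at h0
        convert h0 using 2
        simp; ring
      · rw [← abs_neg] at h1
        convert h1 using 2
        simp; ring
      · rw [← abs_neg] at h3
        convert h3 using 2
        simp; ring
      · ext i; fin_cases i <;> simp [pos]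

set_option maxHeartbeats 800000 in
/-- Dual points lie near the dual cone, with exponent `c / (c - 1)`, and determine the direction
to which they are dual up to a small error. -/
theorem exists_dualPoint_nearCone {c L κ : ℝ} (hc : 1 < c) (hL : 1 ≤ L) (hκ : 0 ≤ κ) :
    ∃ M₀ K C : ℝ, 1 ≤ M₀ ∧ 1 ≤ K ∧ 1 ≤ C ∧ ∀ M Y ρ : ℝ, M₀ ≤ M → 1 ≤ Y → 0 < ρ → ρ ≤ 1 →
      1 ≤ ρ * Y → ∀ a₁ ∈ Set.Icc L⁻¹ L, ∀ a₂ ∈ Set.Icc L⁻¹ L, ∀ a₃ ∈ Set.Icc L⁻¹ L,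
      |a₁ ^ c + a₂ ^ c - a₃ ^ c - 1| ≤ κ * ρ ^ 2 → ∀ m, DualPoint c M Y ρ a₁ a₂ a₃ m →
      ∀ X : ℝ, 1 ≤ X → X ≤ m 2 → m 2 ≤ 2 * X →
        ρ ^ 2 * Y * X ≤ 1 ∧
        NearCone (c / (c - 1)) K X (C / (ρ ^ 2 * Y ^ 2 * X)) m ∧
        |a₁ - ((m 0 : ℝ) / m 3) ^ (c - 1)⁻¹| ≤ C / (ρ * Y * X) ∧
        |a₂ - ((m 1 : ℝ) / m 3) ^ (c - 1)⁻¹| ≤ C / (ρ * Y * X) := by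
  obtain ⟨e₀, L', C, he₀, hL', hC, h⟩ := exists_dual_cone_bound hc hL
  set p := c / (c - 1) with hp
  have hp1 : 1 < p := by rw [hp, one_lt_div (by linarith)]; linarith
  have h2p : (1 : ℝ) ≤ 2 ^ p := Real.one_le_rpow (by norm_num) (by linarith)
  refine ⟨max 1 e₀⁻¹, 2 * L', 2 ^ p * (C * (κ + 2)), le_max_left _ _, by linarith,
    one_le_mul_of_one_le_of_one_le h2p (one_le_mul_of_one_le_of_one_le hC (by linarith)), ?_⟩
  intro M Y ρ hM hY hρ hρ1 hρY a₁ ha₁ a₂ ha₂ a₃ ha₃ ha m hm X hX hXm hmX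
  obtain ⟨-, hm2, hm0, hm1, hm3⟩ := hm
  have hM1 : 1 ≤ M := (le_max_left _ _).trans hM
  have hMe : e₀⁻¹ ≤ M := (le_max_right _ _).trans hM
  set μ : ℝ := (m 2 : ℝ) with hμ
  have hμ1 : 1 ≤ μ := hX.trans hXm
  have hμ0 : 0 < μ := by linarith
  have hY0 : 0 < Y := by linarith
  have hX0 : 0 < X := by linarith
  have hM0 : 0 < M := by linarith
  have hsmall : ρ ^ 2 * Y * μ ≤ 1 := by
    rw [le_div_iff₀ (by positivity)] at hm2
    have : 0 ≤ ρ ^ 2 * Y * μ := by positivity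
    nlinarith
  have hinv : ∀ x r : ℝ, |x| ≤ r → |x / μ| ≤ r / μ := fun x r hx => by
    rw [abs_div, abs_of_pos hμ0]; gcongr
  have hee : 1 / (16 * (M * ρ * Y)) / μ ≤ 1 / (ρ * Y * μ) := by
    rw [div_div]
    refine one_div_le_one_div_of_le (by positivity) (mul_le_mul_of_nonneg_right ?_ hμ0.le)
    nlinarith [mul_pos hρ hY0]
  have hgg : 1 / (16 * (M * Y)) / μ ≤ 1 / (Y * μ) := by
    rw [div_div]
    gcongr
    nlinarith
  have hge : 1 / (16 * (M * Y)) / μ ≤ 1 / (16 * (M * ρ * Y)) / μ := by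
    gcongr
    nlinarith
  have hee₀ : 1 / (16 * (M * ρ * Y)) / μ ≤ e₀ := by
    have h1 : 1 / (16 * (M * ρ * Y)) / μ ≤ 1 / M := by
      rw [div_div]
      gcongr
      have : 1 ≤ ρ * Y * μ := one_le_mul_of_one_le_of_one_le hρY hμ1
      nlinarith
    refine h1.trans ?_
    rw [one_div]
    exact inv_le_of_inv_le₀ he₀ hMe
  obtain ⟨hz₁, hz₂, hz₄, hcone, hb₁, hb₂⟩ := h (1 / (16 * (M * ρ * Y)) / μ) (1 / (16 * (M * Y)) / μ)
    (κ * ρ ^ 2) hge hee₀ a₁ ha₁ a₂ ha₂ a₃ ha₃ (m 0 / μ) (m 1 / μ) (m 3 / μ)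
    (by convert hinv _ _ hm0 using 2; field_simp)
    (by convert hinv _ _ hm1 using 2; field_simp)
    (by convert hinv _ _ hm3 using 2; field_simp) ha
  have hrat : ∀ k : ℤ, (k : ℝ) / μ ∈ Set.Icc L'⁻¹ L' →
      X ≤ 2 * L' * k ∧ (k : ℝ) ≤ 2 * L' * X ∧ 0 < (k : ℝ) := by
    intro k hk
    obtain ⟨hk1, hk2⟩ := hk
    rw [le_div_iff₀ hμ0, inv_mul_le_iff₀ (by linarith)] at hk1
    rw [div_le_iff₀ hμ0] at hk2
    have hk0 : 0 < (k : ℝ) := by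
      by_contra! hcon
      exact absurd (hk1.trans (mul_nonpos_of_nonneg_of_nonpos (by linarith) hcon)) hμ0.not_ge
    have hk3 : L' * μ ≤ L' * (2 * X) := by gcongr
    have hk4 : 0 < L' * k := hμ0.trans_le hk1
    exact ⟨by linarith, by linarith, hk0⟩
  obtain ⟨h0a, h0b, h0⟩ := hrat _ hz₁
  obtain ⟨h1a, h1b, h1⟩ := hrat _ hz₂
  obtain ⟨h3a, h3b, h3⟩ := hrat _ hz₄
  have hdist : C * (1 / (16 * (M * ρ * Y)) / μ) ≤ 2 ^ p * (C * (κ + 2)) / (ρ * Y * X) := by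
    calc C * (1 / (16 * (M * ρ * Y)) / μ) ≤ C * (1 / (ρ * Y * μ)) := by gcongr
      _ ≤ C * (1 / (ρ * Y * X)) := by gcongr
      _ = (1 * (C * 1)) / (ρ * Y * X) := by ring
      _ ≤ _ := by gcongr; linarith
  have hdiv : ∀ x : ℝ, x / μ / (m 3 / μ) = x / m 3 := fun x => by field_simp
  rw [hdiv] at hb₁ hb₂
  refine ⟨?_, ⟨?_, ?_⟩, hb₁.trans hdist, hb₂.trans hdist⟩
  · exact le_trans (by gcongr) hsmall
  · intro i
    fin_cases i
    · exact ⟨h0a, h0b⟩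
    · exact ⟨h1a, h1b⟩
    · refine ⟨?_, ?_⟩
      · change X ≤ 2 * L' * μ
        nlinarith only [hXm, hL', hμ0]
      · change μ ≤ 2 * L' * X
        nlinarith only [hmX, hL', hX0]
    · exact ⟨h3a, h3b⟩
  · have hscale : (m 0 : ℝ) ^ p + (m 1 : ℝ) ^ p - μ ^ p - (m 3 : ℝ) ^ p =
        μ ^ p * ((m 0 / μ) ^ p + (m 1 / μ) ^ p - 1 - (m 3 / μ) ^ p) := by
      have hμp : 0 < μ ^ p := Real.rpow_pos_of_pos hμ0 p
      rw [Real.div_rpow h0.le hμ0.le, Real.div_rpow h1.le hμ0.le, Real.div_rpow h3.le hμ0.le]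
      field_simp
    have herr : κ * ρ ^ 2 + 1 / (16 * (M * Y)) / μ + (1 / (16 * (M * ρ * Y)) / μ) ^ 2 ≤
        (κ + 2) / (ρ * Y * X) ^ 2 := by
      have e1 : ρ ^ 2 ≤ 1 / (ρ * Y * μ) ^ 2 := by
        rw [le_div_iff₀ (by positivity)]
        calc ρ ^ 2 * (ρ * Y * μ) ^ 2 = (ρ ^ 2 * Y * μ) ^ 2 := by ring
          _ ≤ 1 := pow_le_one₀ (by positivity) hsmall
      have e2 : 1 / (Y * μ) ≤ 1 / (ρ * Y * μ) ^ 2 := by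
        rw [div_le_div_iff₀ (by positivity) (by positivity)]
        calc 1 * (ρ * Y * μ) ^ 2 = (ρ ^ 2 * Y * μ) * (Y * μ) := by ring
          _ ≤ 1 * (Y * μ) := by gcongr
      calc κ * ρ ^ 2 + 1 / (16 * (M * Y)) / μ + (1 / (16 * (M * ρ * Y)) / μ) ^ 2
          ≤ κ * (1 / (ρ * Y * μ) ^ 2) + 1 / (ρ * Y * μ) ^ 2 + (1 / (ρ * Y * μ)) ^ 2 := by
            refine add_le_add (add_le_add ?_ (hgg.trans e2)) ?_ <;> gcongr
        _ = (κ + 2) / (ρ * Y * μ) ^ 2 := by ring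
        _ ≤ _ := by gcongr
    change |(m 0 : ℝ) ^ p + (m 1 : ℝ) ^ p - μ ^ p - (m 3 : ℝ) ^ p| ≤ _
    rw [hscale, abs_mul, abs_of_pos (Real.rpow_pos_of_pos hμ0 p)]
    calc μ ^ p * |(m 0 / μ) ^ p + (m 1 / μ) ^ p - 1 - (m 3 / μ) ^ p|
        ≤ (2 * X) ^ p * (C * ((κ + 2) / (ρ * Y * X) ^ 2)) := by
          gcongr
          exact hcone.trans (by gcongr)
      _ = 2 ^ p * (C * (κ + 2)) / (ρ ^ 2 * Y ^ 2 * X) * X ^ (p - 1) := by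
          rw [Real.mul_rpow (by norm_num) hX0.le, Real.rpow_sub_one hX0.ne']
          field_simp

theorem card_le_of_floor_div {ρ E b₁ b₂ : ℝ} (hρ : 0 < ρ) (hE : 0 ≤ E) (U : Finset (ℤ × ℤ))
    (a₁ a₂ : ℤ × ℤ → ℝ) (hU₁ : ∀ u ∈ U, ⌊a₁ u / ρ⌋ = u.1) (hU₂ : ∀ u ∈ U, ⌊a₂ u / ρ⌋ = u.2)
    (ha₁ : ∀ u ∈ U, |a₁ u - b₁| ≤ E) (ha₂ : ∀ u ∈ U, |a₂ u - b₂| ≤ E) :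
    (U.card : ℝ) ≤ (2 * E / ρ + 2) ^ 2 := by
  have hmem : ∀ a b : ℝ, |a - b| ≤ E → ⌊a / ρ⌋ ∈ Icc ⌊(b - E) / ρ⌋ ⌊(b + E) / ρ⌋ := by
    intro a b hab
    rw [abs_le] at hab
    rw [mem_Icc]
    constructor <;> apply Int.floor_le_floor <;> gcongr <;> linarith
  have hcard : ∀ b : ℝ, ((Icc ⌊(b - E) / ρ⌋ ⌊(b + E) / ρ⌋).card : ℝ) ≤ 2 * E / ρ + 2 := by
    intro b
    have hle : ⌊(b - E) / ρ⌋ ≤ ⌊(b + E) / ρ⌋ := by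
      apply Int.floor_le_floor; gcongr; linarith
    have h1 := Int.card_Icc_of_le ⌊(b - E) / ρ⌋ ⌊(b + E) / ρ⌋ (by omega)
    have h2 : ((Icc ⌊(b - E) / ρ⌋ ⌊(b + E) / ρ⌋).card : ℝ) =
        ⌊(b + E) / ρ⌋ + 1 - ⌊(b - E) / ρ⌋ := by exact_mod_cast h1
    rw [h2]
    have h3 := Int.floor_le ((b + E) / ρ)
    have h4 := Int.lt_floor_add_one ((b - E) / ρ)
    have h5 : (b + E) / ρ - (b - E) / ρ = 2 * E / ρ := by ring
    linarith
  have hsub : U ⊆ Icc ⌊(b₁ - E) / ρ⌋ ⌊(b₁ + E) / ρ⌋ ×ˢ Icc ⌊(b₂ - E) / ρ⌋ ⌊(b₂ + E) / ρ⌋ := by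
    intro u hu
    rw [mem_product, ← hU₁ u hu, ← hU₂ u hu]
    exact ⟨hmem _ _ (ha₁ u hu), hmem _ _ (ha₂ u hu)⟩
  have h := card_le_card hsub
  rw [card_product] at h
  calc (U.card : ℝ) ≤ ((Icc ⌊(b₁ - E) / ρ⌋ ⌊(b₁ + E) / ρ⌋).card : ℝ) *
        ((Icc ⌊(b₂ - E) / ρ⌋ ⌊(b₂ + E) / ρ⌋).card : ℝ) := by exact_mod_cast h
    _ ≤ (2 * E / ρ + 2) * (2 * E / ρ + 2) := by
        gcongr <;> apply hcard
    _ = _ := by ring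

open Classical in
theorem sum_card_filter_le_of_level {α β : Type*} (U : Finset α) (B : Finset β)
    (r : α → β → Prop) (level : β → ℕ) (J : ℕ) (N : ℕ → ℝ) (Q : ℝ)
    (hlevel : ∀ u ∈ U, ∀ m ∈ B, r u m → level m < J)
    (hN : ∀ m ∈ B, (∃ u ∈ U, r u m) → ((U.filter (r · m)).card : ℝ) ≤ N (level m))
    (hQ : ∀ j, ((B.filter fun m => (∃ u ∈ U, r u m) ∧ level m = j).card : ℝ) * N j ≤ Q) :
    ∑ u ∈ U, ((B.filter (r u)).card : ℝ) ≤ J * Q := by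
  have hswap : ∑ u ∈ U, ((B.filter (r u)).card : ℝ) =
      ∑ m ∈ B, ((U.filter (r · m)).card : ℝ) := by
    exact_mod_cast sum_card_bipartiteAbove_eq_sum_card_bipartiteBelow (s := U) (t := B) r
  have hrestrict : ∑ m ∈ B, ((U.filter (r · m)).card : ℝ) =
      ∑ m ∈ B.filter (fun m => ∃ u ∈ U, r u m), ((U.filter (r · m)).card : ℝ) := by
    refine (sum_subset (filter_subset _ _) fun m hm hm' => ?_).symm
    rw [Nat.cast_eq_zero, card_eq_zero, filter_eq_empty_iff]
    intro u hu hr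
    exact hm' (mem_filter.mpr ⟨hm, u, hu, hr⟩)
  have hmaps : ∀ m ∈ B.filter (fun m => ∃ u ∈ U, r u m), level m ∈ range J := by
    intro m hm
    obtain ⟨hm, u, hu, hr⟩ := mem_filter.mp hm
    exact mem_range.mpr (hlevel u hu m hm hr)
  rw [hswap, hrestrict, ← sum_fiberwise_of_maps_to hmaps]
  calc _ ≤ ∑ j ∈ range J, Q := by
        refine sum_le_sum fun j _ => le_trans ?_ (hQ j)
        rw [← nsmul_eq_mul, filter_filter]
        refine sum_le_card_nsmul _ _ _ fun m hm => ?_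
        obtain ⟨hmB, hex, rfl⟩ := mem_filter.mp hm
        exact hN m hmB hex
    _ = J * Q := by simp

theorem NearCone.div_mem_Icc {c K Y ρ : ℝ} {n : Fin 4 → ℤ} (hc : 1 < c) (hK : 1 ≤ K) (hY : 1 ≤ Y)
    (h : NearCone c K Y (ρ ^ 2 * Y) n) :
    0 < (n 3 : ℝ) ∧ (∀ i, (n i : ℝ) / n 3 ∈ Set.Icc (K ^ 2)⁻¹ (K ^ 2)) ∧
      |((n 0 : ℝ) / n 3) ^ c + ((n 1 : ℝ) / n 3) ^ c - ((n 2 : ℝ) / n 3) ^ c - 1| ≤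
        K ^ c * ρ ^ 2 := by
  obtain ⟨hn, hcone⟩ := h
  have hK0 : 0 < K := by linarith
  have hY0 : 0 < Y := by linarith
  have hpos : ∀ i, 0 < (n i : ℝ) := fun i => by
    by_contra! hcon
    exact absurd ((hn i).1.trans (mul_nonpos_of_nonneg_of_nonpos hK0.le hcon)) hY0.not_ge
  refine ⟨hpos 3, fun i => ⟨?_, ?_⟩, ?_⟩
  · rw [le_div_iff₀ (hpos 3), inv_mul_le_iff₀ (by positivity)]
    calc (n 3 : ℝ) ≤ K * Y := (hn 3).2
      _ ≤ K * (K * n i) := by gcongr; exact (hn i).1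
      _ = _ := by ring
  · rw [div_le_iff₀ (hpos 3)]
    calc (n i : ℝ) ≤ K * Y := (hn i).2
      _ ≤ K * (K * n 3) := by gcongr; exact (hn 3).1
      _ = _ := by ring
  · have h3 : 0 < (n 3 : ℝ) ^ c := Real.rpow_pos_of_pos (hpos 3) c
    have hscale : ((n 0 : ℝ) / n 3) ^ c + ((n 1 : ℝ) / n 3) ^ c - ((n 2 : ℝ) / n 3) ^ c - 1 =
        ((n 0 : ℝ) ^ c + (n 1 : ℝ) ^ c - (n 2 : ℝ) ^ c - (n 3 : ℝ) ^ c) / (n 3 : ℝ) ^ c := by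
      rw [Real.div_rpow (hpos 0).le (hpos 3).le, Real.div_rpow (hpos 1).le (hpos 3).le,
        Real.div_rpow (hpos 2).le (hpos 3).le]
      field_simp
    rw [hscale, abs_div, abs_of_pos h3, div_le_iff₀ h3]
    calc _ ≤ ρ ^ 2 * Y * Y ^ (c - 1) := hcone
      _ = ρ ^ 2 * Y ^ c := by rw [Real.rpow_sub_one hY0.ne']; field_simp
      _ ≤ ρ ^ 2 * (K * n 3) ^ c := by gcongr; exact (hn 3).1
      _ = _ := by rw [Real.mul_rpow hK0.le (hpos 3).le]; ring

set_option maxHeartbeats 1600000 in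
open Classical in
/-- Cutting the cone into pieces of angular width `ρ` and passing to the dual cone. -/
theorem EnergyBound.exists_card_le {s : ℝ} (hs : 0 < s) (h : EnergyBound (2 + s)) {c K : ℝ}
    (hc : 1 < c) (hK : 1 ≤ K) :
    ∃ C : ℝ, 0 < C ∧ ∀ Y ρ : ℝ, 1 ≤ Y → 0 < ρ → ρ ≤ 1 → 1 ≤ ρ * Y →
      ∀ S : Finset (Fin 4 → ℤ), (∀ n ∈ S, NearCone c K Y (ρ ^ 2 * Y) n) →
        (S.card : ℝ) ≤ C * (ρ ^ 2 * Y ^ 4 +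
          (Real.logb 2 Y + 1) * Y ^ 2 * ((ρ ^ 2 * Y) ^ (-s) + 1)) := by
  have hL : 1 ≤ K ^ 2 := one_le_pow₀ hK
  have hκ : 0 ≤ K ^ c := by positivity
  obtain ⟨C₀, hC₀, htangent⟩ := exists_tangent_plane_bound hc hL hκ
  obtain ⟨M₀, K', C₁, hM₀, hK', hC₁, hdual⟩ := exists_dualPoint_nearCone hc hL hκ
  obtain ⟨C₂, hC₂, henergy⟩ := h (c / (c - 1)) K' (by rw [one_lt_div (by linarith)]; linarith) hK'
  set M := max M₀ (K * C₀) with hM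
  have hMM₀ : M₀ ≤ M := le_max_left _ _
  have hMC : K * C₀ ≤ M := le_max_right _ _
  have hM1 : 1 ≤ M := hM₀.trans hMM₀
  have hMK : K ≤ M := (le_mul_of_one_le_right (by linarith) hC₀).trans hMC
  set C₃ := C₂ * (2 * C₁ + 2) ^ 2 * C₁ with hC₃
  refine ⟨2 ^ 25 * M ^ 4 * (16 * K ^ 4 + 2 * C₃), by positivity, ?_⟩
  intro Y ρ hY hρ hρ1 hρY S hS
  have hY0 : 0 < Y := by linarith
  have hK0 : 0 < K := by linarith
  have hnorm := fun n hn => (hS n hn).div_mem_Icc hc hK hY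
  let cell (n : Fin 4 → ℤ) : ℤ × ℤ := (⌊(n 0 : ℝ) / n 3 / ρ⌋, ⌊(n 1 : ℝ) / n 3 / ρ⌋)
  have hrep : ∀ u : ℤ × ℤ, ∃ n, u ∈ S.image cell → n ∈ S ∧ cell n = u := by
    intro u
    by_cases hu : u ∈ S.image cell
    · obtain ⟨n, hn⟩ := mem_image.mp hu
      exact ⟨n, fun _ => hn⟩
    · exact ⟨0, fun hu' => absurd hu' hu⟩
  choose rep hrep using hrep
  let a (i : Fin 4) (u : ℤ × ℤ) : ℝ := (rep u i : ℝ) / rep u 3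
  have ha : ∀ u ∈ S.image cell, ∀ i, a i u ∈ Set.Icc (K ^ 2)⁻¹ (K ^ 2) :=
    fun u hu => (hnorm _ (hrep u hu).1).2.1
  have hacone : ∀ u ∈ S.image cell, |a 0 u ^ c + a 1 u ^ c - a 2 u ^ c - 1| ≤ K ^ c * ρ ^ 2 :=
    fun u hu => (hnorm _ (hrep u hu).1).2.2
  have hfloor₁ : ∀ u ∈ S.image cell, ⌊a 0 u / ρ⌋ = u.1 :=
    fun u hu => congrArg Prod.fst (hrep u hu).2
  have hfloor₂ : ∀ u ∈ S.image cell, ⌊a 1 u / ρ⌋ = u.2 :=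
    fun u hu => congrArg Prod.snd (hrep u hu).2
  let r (u : ℤ × ℤ) (m : Fin 4 → ℤ) : Prop := DualPoint c M Y ρ (a 0 u) (a 1 u) (a 2 u) m
  let level (m : Fin 4 → ℤ) : ℕ := Nat.log 2 (m 2).toNat
  -- what a dual point satisfies at its own dyadic level
  have hlev : ∀ u ∈ S.image cell, ∀ m, r u m → ρ ^ 2 * Y * 2 ^ level m ≤ 1 ∧
      NearCone (c / (c - 1)) K' (2 ^ level m) (C₁ / (ρ ^ 2 * Y ^ 2 * 2 ^ level m)) m ∧
      |a 0 u - ((m 0 : ℝ) / m 3) ^ (c - 1)⁻¹| ≤ C₁ / (ρ * Y * 2 ^ level m) ∧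
      |a 1 u - ((m 1 : ℝ) / m 3) ^ (c - 1)⁻¹| ≤ C₁ / (ρ * Y * 2 ^ level m) := by
    intro u hu m hm
    have hm2 : 0 < m 2 := hm.1
    have hcast : ((m 2).toNat : ℤ) = m 2 := Int.toNat_of_nonneg hm2.le
    have hcast' : ((m 2).toNat : ℝ) = m 2 := by exact_mod_cast congrArg (Int.cast (R := ℝ)) hcast
    refine hdual M Y ρ hMM₀ hY hρ hρ1 hρY _ (ha u hu 0) _ (ha u hu 1) _ (ha u hu 2)
      (hacone u hu) m hm (2 ^ level m) (one_le_pow₀ (by norm_num)) ?_ ?_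
    · rw [← hcast']
      exact_mod_cast Nat.pow_log_le_self 2 (by omega)
    · rw [← hcast', mul_comm, ← pow_succ]
      exact_mod_cast (Nat.lt_pow_succ_log_self (by norm_num) _).le
  have hlevY : ∀ j : ℕ, ρ ^ 2 * Y * 2 ^ j ≤ 1 → (2 : ℝ) ^ j ≤ Y := by
    intro j hj
    have h1 : 1 ≤ (ρ * Y) ^ 2 := one_le_pow₀ hρY
    have h2 : (0 : ℝ) < 2 ^ j := by positivity
    calc (2 : ℝ) ^ j ≤ (ρ * Y) ^ 2 * 2 ^ j := le_mul_of_one_le_left h2.le h1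
      _ = (ρ ^ 2 * Y * 2 ^ j) * Y := by ring
      _ ≤ 1 * Y := by gcongr
      _ = Y := one_mul Y
  let B : Finset (Fin 4 → ℤ) := Fintype.piFinset fun _ => Icc 0 ⌊K' * Y⌋
  have hB : ∀ u ∈ S.image cell, ∀ m, r u m → m ∈ B := by
    intro u hu m hm
    obtain ⟨h1, ⟨h2, -⟩, -⟩ := hlev u hu m hm
    refine Fintype.mem_piFinset.mpr fun i => mem_Icc.mpr ⟨?_, ?_⟩
    · have h3 : (0 : ℝ) < K' * m i := lt_of_lt_of_le (by positivity) (h2 i).1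
      have h4 : 0 < (m i : ℝ) := pos_of_mul_pos_right h3 (by linarith)
      exact_mod_cast h4.le
    · refine Int.le_floor.mpr ((h2 i).2.trans ?_)
      gcongr
      exact hlevY _ h1
  let N (j : ℕ) : ℝ := ((2 * C₁ + 2) / (ρ ^ 2 * Y * 2 ^ j)) ^ 2
  let Q : ℝ := C₃ / (ρ ^ 4 * Y ^ 2) * ((ρ ^ 2 * Y) ^ (-s) + 1)
  have hQ0 : 0 ≤ Q := by positivity
  have hsum : ∑ u ∈ S.image cell, ((B.filter (r u)).card : ℝ) ≤ (⌊Real.logb 2 Y⌋₊ + 1 : ℕ) * Q := by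
    refine sum_card_filter_le_of_level (S.image cell) B r level (⌊Real.logb 2 Y⌋₊ + 1) N Q ?_ ?_ ?_
    · intro u hu m _ hm
      refine Nat.lt_succ_of_le (Nat.le_floor ?_)
      rw [Real.le_logb_iff_rpow_le (by norm_num) hY0, Real.rpow_natCast]
      exact hlevY _ (hlev u hu m hm).1
    · rintro m - ⟨u, hu, hm⟩
      have h1 := (hlev u hu m hm).1
      refine (card_le_of_floor_div hρ (E := C₁ / (ρ * Y * 2 ^ level m)) (by positivity) _ (a 0) (a 1)
        (fun v hv => hfloor₁ v (mem_filter.mp hv).1) (fun v hv => hfloor₂ v (mem_filter.mp hv).1)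
        (fun v hv => (hlev v (mem_filter.mp hv).1 m (mem_filter.mp hv).2).2.2.1)
        (fun v hv => (hlev v (mem_filter.mp hv).1 m (mem_filter.mp hv).2).2.2.2)).trans ?_
      refine pow_le_pow_left₀ (by positivity) ?_ 2
      have h2 : 1 ≤ 1 / (ρ ^ 2 * Y * 2 ^ level m) := by
        rw [le_div_iff₀ (by positivity)]; linarith
      calc _ = 2 * C₁ * (1 / (ρ ^ 2 * Y * 2 ^ level m)) + 2 := by field_simp
        _ ≤ 2 * C₁ * (1 / (ρ ^ 2 * Y * 2 ^ level m)) + 2 * (1 / (ρ ^ 2 * Y * 2 ^ level m)) := by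
            linarith
        _ = _ := by ring
    · intro j
      rcases (B.filter fun m => (∃ u ∈ S.image cell, r u m) ∧ level m = j).eq_empty_or_nonempty
        with hemp | ⟨m₀, hm₀⟩
      · rw [hemp]; simpa using hQ0
      · obtain ⟨-, ⟨u₀, hu₀, hru₀⟩, rfl⟩ := mem_filter.mp hm₀
        have h1 := (hlev u₀ hu₀ m₀ hru₀).1
        set X : ℝ := 2 ^ level m₀ with hX
        have hX1 : 1 ≤ X := one_le_pow₀ (by norm_num)
        have hX0 : 0 < X := by linarith
        have hW := henergy X (C₁ / (ρ ^ 2 * Y ^ 2 * X)) hX1 (by positivity)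
          (B.filter fun m => (∃ u ∈ S.image cell, r u m) ∧ level m = level m₀) (by
            intro m hm
            obtain ⟨-, ⟨u, hu, hm⟩, hmj⟩ := mem_filter.mp hm
            have := (hlev u hu m hm).2.1
            rwa [hmj] at this)
        have hXs : X ^ s ≤ (ρ ^ 2 * Y) ^ (-s) := by
          rw [Real.rpow_neg (by positivity), ← Real.inv_rpow (by positivity)]
          refine Real.rpow_le_rpow hX0.le ?_ hs.le
          rw [le_inv_comm₀ hX0 (by positivity), ← one_div, le_div_iff₀ hX0]
          exact h1
        have hρY2 : C₁ / (ρ * Y) ^ 2 ≤ C₁ :=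
          div_le_self (by linarith) (one_le_pow₀ hρY)
        calc _ ≤ C₂ * (X ^ (2 + s) + C₁ / (ρ ^ 2 * Y ^ 2 * X) * X ^ 3) * N (level m₀) := by
              gcongr
          _ = C₂ * (2 * C₁ + 2) ^ 2 / (ρ ^ 4 * Y ^ 2) * (X ^ s + C₁ / (ρ * Y) ^ 2) := by
              rw [Real.rpow_add hX0, Real.rpow_two]
              simp only [N, ← hX]
              field_simp
          _ ≤ C₂ * (2 * C₁ + 2) ^ 2 / (ρ ^ 4 * Y ^ 2) * (C₁ * (ρ ^ 2 * Y) ^ (-s) + C₁) := by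
              gcongr
              exact hXs.trans (le_mul_of_one_le_left (by positivity) hC₁)
          _ = Q := by simp only [Q, hC₃]; ring
  have hcells : ((S.image cell).card : ℝ) ≤ 16 * K ^ 4 / ρ ^ 2 := by
    have habs : ∀ i, ∀ u ∈ S.image cell, |a i u - 0| ≤ K ^ 2 := fun i u hu => by
      rw [sub_zero, abs_of_nonneg (le_trans (by positivity) (ha u hu i).1)]
      exact (ha u hu i).2
    refine (card_le_of_floor_div hρ (by positivity) _ (a 0) (a 1) hfloor₁ hfloor₂ (habs 0)
      (habs 1)).trans ?_
    have h1 : 1 ≤ K ^ 2 / ρ := by rw [le_div_iff₀ hρ]; linarith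
    calc (2 * K ^ 2 / ρ + 2) ^ 2 ≤ (4 * (K ^ 2 / ρ)) ^ 2 := by
          refine pow_le_pow_left₀ (by positivity) ?_ 2
          have : 2 * K ^ 2 / ρ = 2 * (K ^ 2 / ρ) := by ring
          linarith
      _ = _ := by ring
  have hpiece : ∀ u ∈ S.image cell, ((S.filter fun n => cell n = u).card : ℝ) ≤
      2 ^ 25 * M ^ 4 * ρ ^ 4 * Y ^ 4 * (1 + 2 * (B.filter (r u)).card) := by
    intro u hu
    refine card_le_of_dualPoint (c := c) (a₁ := a 0 u) (a₂ := a 1 u) (a₃ := a 2 u) hM1 hY hρ hρY _ _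
      ?_ (fun m hm => mem_filter.mpr ⟨hB u hu m hm, hm⟩)
    intro n hn
    obtain ⟨hnS, hnu⟩ := mem_filter.mp hn
    obtain ⟨hn3, hx, hxcone⟩ := hnorm n hnS
    have hn3Y : (n 3 : ℝ) ≤ K * Y := ((hS n hnS).1 3).2
    have hclose : ∀ x y : ℝ, ⌊x / ρ⌋ = ⌊y / ρ⌋ → |x - y| ≤ ρ := by
      intro x y hxy
      have h1 := (Int.abs_sub_lt_one_of_floor_eq_floor hxy).le
      rw [← sub_div, abs_div, abs_of_pos hρ, div_le_one hρ] at h1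
      exact h1
    have hd₁ : |(n 0 : ℝ) / n 3 - a 0 u| ≤ ρ :=
      hclose _ _ ((congrArg Prod.fst hnu).trans (hfloor₁ u hu).symm)
    have hd₂ : |(n 1 : ℝ) / n 3 - a 1 u| ≤ ρ :=
      hclose _ _ ((congrArg Prod.snd hnu).trans (hfloor₂ u hu).symm)
    have ht := htangent ρ hρ.le hρ1 _ (hx 0) _ (hx 1) _ (hx 2) _ (ha u hu 0) _ (ha u hu 1) _
      (ha u hu 2) hd₁ hd₂ hxcone (hacone u hu)
    have hmul : ∀ x y b : ℝ, 0 ≤ b → x = y * n 3 → |y| ≤ b → |x| ≤ b * (K * Y) := by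
      intro x y b hb hxy hy
      rw [hxy, abs_mul, abs_of_pos hn3]
      gcongr
    have hKρ : ρ * (K * Y) ≤ M * ρ * Y := by
      calc ρ * (K * Y) = K * ρ * Y := by ring
        _ ≤ _ := by gcongr
    refine ⟨(hmul _ _ _ hρ.le ?_ hd₁).trans hKρ, (hmul _ _ _ hρ.le ?_ hd₂).trans hKρ, ?_,
      (hmul _ _ _ (by positivity) ?_ ht).trans ?_⟩
    · field_simp
    · field_simp
    · rw [abs_of_pos hn3]
      exact hn3Y.trans (by gcongr)
    · field_simp
    · calc C₀ * ρ ^ 2 * (K * Y) = K * C₀ * ρ ^ 2 * Y := by ring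
        _ ≤ _ := by gcongr
  have hlog : ((⌊Real.logb 2 Y⌋₊ + 1 : ℕ) : ℝ) ≤ Real.logb 2 Y + 1 := by
    push_cast
    gcongr
    exact Nat.floor_le (Real.logb_nonneg (by norm_num) hY)
  have hcount : (S.card : ℝ) =
      ∑ u ∈ S.image cell, ((S.filter fun n => cell n = u).card : ℝ) := by
    exact_mod_cast card_eq_sum_card_image cell S
  have hlog0 : 0 ≤ Real.logb 2 Y := Real.logb_nonneg (by norm_num) hY
  have hC₃0 : 0 < C₃ := by positivity
  calc (S.card : ℝ) ≤ ∑ u ∈ S.image cell,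
        2 ^ 25 * M ^ 4 * ρ ^ 4 * Y ^ 4 * (1 + 2 * ((B.filter (r u)).card : ℝ)) := by
        rw [hcount]; exact sum_le_sum hpiece
    _ = 2 ^ 25 * M ^ 4 * ρ ^ 4 * Y ^ 4 *
        ((S.image cell).card + 2 * ∑ u ∈ S.image cell, ((B.filter (r u)).card : ℝ)) := by
        rw [← mul_sum, sum_add_distrib, ← mul_sum]; simp
    _ ≤ 2 ^ 25 * M ^ 4 * ρ ^ 4 * Y ^ 4 *
        (16 * K ^ 4 / ρ ^ 2 + 2 * ((Real.logb 2 Y + 1) * Q)) := by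
        gcongr
        exact hsum.trans (by gcongr)
    _ = 2 ^ 25 * M ^ 4 * (16 * K ^ 4 * (ρ ^ 2 * Y ^ 4) + 2 * C₃ *
          ((Real.logb 2 Y + 1) * Y ^ 2 * ((ρ ^ 2 * Y) ^ (-s) + 1))) := by
        simp only [Q]; field_simp
    _ ≤ 2 ^ 25 * M ^ 4 * ((16 * K ^ 4 + 2 * C₃) * (ρ ^ 2 * Y ^ 4 +
          (Real.logb 2 Y + 1) * Y ^ 2 * ((ρ ^ 2 * Y) ^ (-s) + 1))) := by
        gcongr
        have h1 : 0 ≤ K ^ 4 := by positivity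
        have h2 : 0 ≤ ρ ^ 2 * Y ^ 4 := by positivity
        have h3 : 0 ≤ (Real.logb 2 Y + 1) * Y ^ 2 * ((ρ ^ 2 * Y) ^ (-s) + 1) := by positivity
        have h4 := mul_nonneg h1 h3
        have h5 := mul_nonneg hC₃0.le h2
        linarith
    _ = _ := by ring

theorem NearCone.mono {c K Y δ δ' : ℝ} {n : Fin 4 → ℤ} (hY : 0 ≤ Y) (hδ : δ ≤ δ')
    (h : NearCone c K Y δ n) : NearCone c K Y δ' n :=
  ⟨h.1, h.2.trans (by gcongr)⟩

theorem card_le_of_nearCone {c K Y δ : ℝ} (hK : 1 ≤ K) (hY : 1 ≤ Y) (S : Finset (Fin 4 → ℤ))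
    (hS : ∀ n ∈ S, NearCone c K Y δ n) : (S.card : ℝ) ≤ K ^ 4 * Y ^ 4 := by
  have hsub : S ⊆ Fintype.piFinset fun _ => Icc 1 ⌊K * Y⌋ := by
    intro n hn
    refine Fintype.mem_piFinset.mpr fun i => mem_Icc.mpr ⟨?_, Int.le_floor.mpr ((hS n hn).1 i).2⟩
    have h1 : 0 < K * n i := by linarith [((hS n hn).1 i).1]
    have h2 : 0 < (n i : ℝ) := pos_of_mul_pos_right h1 (by linarith)
    exact_mod_cast h2
  have hcard := card_le_card hsub
  rw [Fintype.card_piFinset] at hcard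
  simp only [Int.card_Icc, prod_const, card_univ, Fintype.card_fin, add_sub_cancel_right] at hcard
  have hKY : 0 ≤ K * Y := by positivity
  have hfloor : ((⌊K * Y⌋.toNat : ℕ) : ℝ) ≤ K * Y := by
    rw [Int.floor_toNat]
    exact Nat.floor_le hKY
  calc (S.card : ℝ) ≤ (⌊K * Y⌋.toNat : ℝ) ^ 4 := by exact_mod_cast hcard
    _ ≤ (K * Y) ^ 4 := by gcongr
    _ = _ := by ring

theorem energyBound_four : EnergyBound 4 := by
  intro c K _ hK
  refine ⟨K ^ 4, by positivity, fun Y δ hY hδ S hS => (card_le_of_nearCone hK hY S hS).trans ?_⟩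
  gcongr
  have h1 : Y ^ (4 : ℝ) = Y ^ 4 := by exact_mod_cast Real.rpow_natCast Y 4
  rw [h1]
  exact le_add_of_nonneg_right (by positivity)

/-- The bootstrapping step. -/
theorem EnergyBound.improve {s s' : ℝ} (hs : 0 < s) (hss' : s / (1 + s) < s')
    (h : EnergyBound (2 + s)) : EnergyBound (2 + s') := by
  intro c K hc hK
  obtain ⟨C, hC, hcard⟩ := h.exists_card_le hs hc hK
  set ε := s' - s / (1 + s) with hε
  have hε0 : 0 < ε := by linarith
  have hlog2 : 0 < Real.log 2 := Real.log_pos (by norm_num)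
  set C' := 1 / (ε * Real.log 2) + 1 with hC'
  have hC'0 : 0 < C' := by positivity
  refine ⟨K ^ 4 + C * (1 + 2 * C'), by positivity, fun Y δ hY hδ S hS => ?_⟩
  have hY0 : 0 < Y := by linarith
  rcases le_or_gt Y δ with hYδ | hδY
  · calc (S.card : ℝ) ≤ K ^ 4 * Y ^ 4 := card_le_of_nearCone hK hY S hS
      _ = K ^ 4 * (0 + Y * Y ^ 3) := by ring
      _ ≤ (K ^ 4 + C * (1 + 2 * C')) * (Y ^ (2 + s') + δ * Y ^ 3) := by
          gcongr
          · exact le_add_of_nonneg_right (by positivity)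
          · positivity
  set θ := 1 / (1 + s) with hθ
  have hθ0 : 0 < θ := by positivity
  have hθ1 : θ ≤ 1 := by rw [hθ, div_le_one (by linarith)]; linarith
  have hθs : θ * s = s / (1 + s) := by rw [hθ]; ring
  have hθs' : 1 - θ = s / (1 + s) := by rw [hθ]; field_simp; ring
  set δ' := max δ (Y ^ (-θ)) with hδ'
  have hδ'0 : 0 < δ' := hδ.trans_le (le_max_left _ _)
  have hδ'Y : δ' ≤ Y :=
    max_le hδY.le ((Real.rpow_le_one_of_one_le_of_nonpos hY (by linarith)).trans hY)
  set ρ := √(δ' / Y) with hρ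
  have hρ0 : 0 < ρ := Real.sqrt_pos.mpr (by positivity)
  have hρsq : ρ ^ 2 * Y = δ' := by
    rw [hρ, Real.sq_sqrt (by positivity)]; field_simp
  have hρ1 : ρ ≤ 1 := Real.sqrt_le_one.mpr ((div_le_one hY0).mpr hδ'Y)
  have hYθ : Y ^ (-θ) * Y = Y ^ (s / (1 + s)) := by
    rw [← Real.rpow_add_one hY0.ne', ← hθs']; ring_nf
  have hYs : 1 ≤ Y ^ (s / (1 + s)) := Real.one_le_rpow hY (by positivity)
  have hρY : 1 ≤ ρ * Y := by
    have h1 : 1 ≤ (ρ * Y) ^ 2 := by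
      calc 1 ≤ Y ^ (-θ) * Y := by rw [hYθ]; exact hYs
        _ ≤ δ' * Y := by gcongr; exact le_max_right _ _
        _ = (ρ * Y) ^ 2 := by rw [← hρsq]; ring
    exact (one_le_sq_iff₀ (by positivity)).mp h1
  have hmain := hcard Y ρ hY hρ0 hρ1 hρY S fun n hn =>
    (hS n hn).mono hY0.le (by rw [hρsq]; exact le_max_left _ _)
  rw [hρsq] at hmain
  have hsplit : Y ^ (2 + s') = Y ^ 2 * Y ^ (s / (1 + s)) * Y ^ ε := by
    rw [← Real.rpow_natCast Y 2, ← Real.rpow_add hY0, ← Real.rpow_add hY0, hε]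
    push_cast; ring_nf
  have hYε : 1 ≤ Y ^ ε := Real.one_le_rpow hY hε0.le
  have hfirst : ρ ^ 2 * Y ^ 4 ≤ Y ^ (2 + s') + δ * Y ^ 3 := by
    calc ρ ^ 2 * Y ^ 4 = δ' * Y ^ 3 := by rw [← hρsq]; ring
      _ ≤ (δ + Y ^ (-θ)) * Y ^ 3 := by
          gcongr
          exact max_le (le_add_of_nonneg_right (by positivity)) (le_add_of_nonneg_left hδ.le)
      _ = Y ^ 2 * (Y ^ (-θ) * Y) * 1 + δ * Y ^ 3 := by ring
      _ ≤ _ := by rw [hYθ, hsplit]; gcongr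
  have hpow : δ' ^ (-s) + 1 ≤ 2 * Y ^ (s / (1 + s)) := by
    have h1 : δ' ^ (-s) ≤ (Y ^ (-θ)) ^ (-s) :=
      Real.rpow_le_rpow_of_nonpos (by positivity) (le_max_right _ _) (by linarith)
    rw [← Real.rpow_mul hY0.le, neg_mul_neg, hθs] at h1
    linarith
  have hlog : Real.logb 2 Y + 1 ≤ C' * Y ^ ε := by
    have h1 : Real.logb 2 Y ≤ 1 / (ε * Real.log 2) * Y ^ ε := by
      calc Real.logb 2 Y = Real.log Y / Real.log 2 := rfl
        _ ≤ Y ^ ε / ε / Real.log 2 := by gcongr; exact Real.log_le_rpow_div hY0.le hε0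
        _ = _ := by field_simp
    rw [hC', add_mul, one_mul]
    linarith
  have hsecond : (Real.logb 2 Y + 1) * Y ^ 2 * (δ' ^ (-s) + 1) ≤ 2 * C' * Y ^ (2 + s') := by
    calc _ ≤ C' * Y ^ ε * Y ^ 2 * (2 * Y ^ (s / (1 + s))) := by gcongr
      _ = _ := by rw [hsplit]; ring
  have hδY3 : 0 ≤ δ * Y ^ 3 := by positivity
  calc (S.card : ℝ) ≤ C * ((Y ^ (2 + s') + δ * Y ^ 3) + 2 * C' * (Y ^ (2 + s') + δ * Y ^ 3)) := by
        refine hmain.trans (mul_le_mul_of_nonneg_left (add_le_add hfirst (hsecond.trans ?_)) hC.le)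
        gcongr
        linarith
    _ = C * (1 + 2 * C') * (Y ^ (2 + s') + δ * Y ^ 3) := by ring
    _ ≤ _ := by
        gcongr
        exact le_add_of_nonneg_left (by positivity)

theorem energyBound_two_add (k : ℕ) : EnergyBound (2 + 2 / (k + 1)) := by
  induction k with
  | zero => norm_num; exact energyBound_four
  | succ k ih =>
    refine ih.improve (by positivity) ?_
    push_cast
    have hk : (0 : ℝ) ≤ k := k.cast_nonneg
    have h1 : (2 : ℝ) / (k + 1) / (1 + 2 / (k + 1)) = 2 / (k + 3) := by
      field_simp; ring
    rw [h1]
    exact div_lt_div_of_pos_left (by norm_num) (by positivity) (by linarith)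

/-- The Robert–Sargos fourth-moment counting theorem for the sequence `n^c`. -/
theorem stmt_7 (c : ℝ) (hc1 : 1 < c) (hc : ∀ k : ℤ, c ≠ k) (η : ℝ) (hη : 0 < η) :
    ∃ C : ℝ, 0 < C ∧ ∀ Y γ : ℝ, 1 < Y → 0 < γ →
      (((((Finset.Ioc ⌊Y⌋₊ ⌊2 * Y⌋₊) ×ˢ (Finset.Ioc ⌊Y⌋₊ ⌊2 * Y⌋₊)) ×ˢ
          ((Finset.Ioc ⌊Y⌋₊ ⌊2 * Y⌋₊) ×ˢ (Finset.Ioc ⌊Y⌋₊ ⌊2 * Y⌋₊))).filter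
        (fun q => |(q.1.1 : ℝ) ^ c + (q.1.2 : ℝ) ^ c - (q.2.1 : ℝ) ^ c - (q.2.2 : ℝ) ^ c| <
          γ)).card : ℝ) ≤ C * (γ * Y ^ (4 - c) + Y ^ 2) * Y ^ η := by
  obtain ⟨k, hk⟩ := exists_nat_gt (2 / η)
  obtain ⟨C, hC, hcard⟩ := energyBound_two_add k c 2 hc1 (by norm_num)
  refine ⟨C, hC, fun Y γ hY hγ => ?_⟩
  have hY0 : 0 < Y := by linarith
  set F := ((((Finset.Ioc ⌊Y⌋₊ ⌊2 * Y⌋₊) ×ˢ (Finset.Ioc ⌊Y⌋₊ ⌊2 * Y⌋₊)) ×ˢ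
          ((Finset.Ioc ⌊Y⌋₊ ⌊2 * Y⌋₊) ×ˢ (Finset.Ioc ⌊Y⌋₊ ⌊2 * Y⌋₊))).filter
        (fun q => |(q.1.1 : ℝ) ^ c + (q.1.2 : ℝ) ^ c - (q.2.1 : ℝ) ^ c - (q.2.2 : ℝ) ^ c| <
          γ)) with hF
  let vec (q : (ℕ × ℕ) × ℕ × ℕ) : Fin 4 → ℤ := ![q.1.1, q.1.2, q.2.1, q.2.2]
  have hinj : Function.Injective vec := by
    rintro ⟨⟨a, b⟩, ⟨x, y⟩⟩ ⟨⟨a', b'⟩, ⟨x', y'⟩⟩ hq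
    have h0 := congrFun hq 0
    have h1 := congrFun hq 1
    have h2 := congrFun hq 2
    have h3 := congrFun hq 3
    simp [vec] at h0 h1 h2 h3
    simp [h0, h1, h2, h3]
  have hmem : ∀ m ∈ Finset.Ioc ⌊Y⌋₊ ⌊2 * Y⌋₊, Y ≤ 2 * (m : ℝ) ∧ (m : ℝ) ≤ 2 * Y := by
    intro m hm
    obtain ⟨h1, h2⟩ := Finset.mem_Ioc.mp hm
    have h3 := (Nat.floor_lt hY0.le).mp h1
    exact ⟨by linarith, (Nat.le_floor_iff (by linarith)).mp h2⟩
  have hbound := hcard Y (γ * Y ^ (1 - c)) hY.le (by positivity) (F.image vec) (by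
    intro n hn
    obtain ⟨q, hq, rfl⟩ := Finset.mem_image.mp hn
    simp only [hF, Finset.mem_filter, Finset.mem_product] at hq
    obtain ⟨⟨⟨h0, h1⟩, h2, h3⟩, hlt⟩ := hq
    refine ⟨fun i => ?_, ?_⟩
    · fin_cases i
      · exact_mod_cast hmem _ h0
      · exact_mod_cast hmem _ h1
      · exact_mod_cast hmem _ h2
      · exact_mod_cast hmem _ h3
    · have h4 : γ * Y ^ (1 - c) * Y ^ (c - 1) = γ := by
        rw [mul_assoc, ← Real.rpow_add hY0]; simp
      rw [h4]
      simpa [vec] using hlt.le)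
  rw [Finset.card_image_of_injective _ hinj] at hbound
  have hk' : (2 : ℝ) / (k + 1) ≤ η := by
    rw [div_lt_iff₀ hη] at hk
    rw [div_le_iff₀ (by positivity)]
    linarith
  have hYη : 1 ≤ Y ^ η := Real.one_le_rpow hY.le hη.le
  have hpow : Y ^ (2 + 2 / (k + 1) : ℝ) ≤ Y ^ 2 * Y ^ η := by
    rw [Real.rpow_add hY0, Real.rpow_two]
    gcongr
    exact hY.le
  have hγ' : γ * Y ^ (1 - c) * Y ^ 3 = γ * Y ^ (4 - c) := by
    rw [mul_assoc, ← Real.rpow_natCast Y 3, ← Real.rpow_add hY0]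
    push_cast; ring_nf
  rw [hγ'] at hbound
  refine hbound.trans ?_
  rw [mul_assoc]
  gcongr
  have hγ0 : γ * Y ^ (4 - c) ≤ γ * Y ^ (4 - c) * Y ^ η := le_mul_of_one_le_right (by positivity) hYη
  linarith
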